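/- Consider a mechanical control system on T*ℝ^d. If every vertical shear (q,p) ↦ (q, p − ∇f(q)), f ∈ C^∞(ℝ^d, ℝ), and every horizontal shear (q,p) ↦ (q + ∇g(p), p), g ∈ C^∞(ℝ^d, ℝ), is small-time approximately reachable, then every Hamiltonian diffeomorphism of T*ℝ^d is small-time approximately reachable. -/

import Mathlib

open MeasureTheory Real

noncomputable section

/-- The phase space `T*ℝ^d = ℝ^d × ℝ^d` (positions `q` and momenta `p`),
identified with `ℝ^{2d}` with the sup norm and the Lebesgue (symplectic volume) measure. -/
abbrev Phase (d : ℕ) := (Fin d → ℝ) × (Fin d → ℝ)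

/-- The Hamiltonian vector field of a function `H : Phase d → ℝ`:
`H⃗(q,p) = (∂_p H(q,p), −∂_q H(q,p))`. -/
def hamVF {d : ℕ} (H : Phase d → ℝ) (x : Phase d) : Phase d :=
  (fun i => fderiv ℝ H x (0, Pi.single i 1),
   fun i => -(fderiv ℝ H x (Pi.single i 1, 0)))

/-- `φ` is the global flow of the (complete) vector field `X`. -/
def IsFlowOf {d : ℕ} (X : Phase d → Phase d) (φ : ℝ → Phase d → Phase d) : Prop :=
  (∀ x, φ 0 x = x) ∧ ∀ x t, HasDerivAt (fun s => φ s x) (X (φ t x)) t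

/-- `Φ` is a smooth diffeomorphism of phase space. -/
def IsDiffeo {d : ℕ} (Φ : Phase d → Phase d) : Prop :=
  ContDiff ℝ (⊤ : ℕ∞) Φ ∧
    ∃ Ψ, ContDiff ℝ (⊤ : ℕ∞) Ψ ∧ Function.LeftInverse Ψ Φ ∧ Function.RightInverse Ψ Φ

/-- `Φ` is a Hamiltonian diffeomorphism of `T*ℝ^d`: a smooth diffeomorphism which is the
time-1 flow map of a smooth time-dependent Hamiltonian whose non-autonomous Hamiltonian flow
is defined on `[0,1]` from every initial point. -/
def IsHamDiffeo {d : ℕ} (Φ : Phase d → Phase d) : Prop :=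
  IsDiffeo Φ ∧
  ∃ (H : ℝ → Phase d → ℝ) (φ : ℝ → Phase d → Phase d),
    ContDiff ℝ (⊤ : ℕ∞) (fun z : ℝ × Phase d => H z.1 z.2) ∧
    (∀ x, φ 0 x = x) ∧
    (∀ x, ∀ t ∈ Set.Icc (0:ℝ) 1,
      HasDerivWithinAt (fun s => φ s x) (hamVF (H t) (φ t x)) (Set.Icc (0:ℝ) 1) t) ∧
    Φ = φ 1

/-- `Φ` is the flow map from time `0` to time `τ` of the time-dependent Hamiltonian vector
field `H⃗_{u(t)}` for some piecewise constant control `u(·) : [0,τ] → U` (finitely many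
pieces): i.e. `Φ` is a finite composition of flows of the autonomous fields `H⃗_{u_i}`
for nonnegative durations summing to `τ`. -/
def Reachable {d : ℕ} {U : Type*} (Ham : U → Phase d → ℝ) (τ : ℝ)
    (Φ : Phase d → Phase d) : Prop :=
  ∃ (n : ℕ) (dur : Fin n → ℝ) (u : Fin n → U) (φ : Fin n → ℝ → Phase d → Phase d),
    (∀ i, 0 ≤ dur i) ∧ (∑ i, dur i) = τ ∧
    (∀ i, IsFlowOf (hamVF (Ham (u i))) (φ i)) ∧
    Φ = (List.ofFn (fun i => φ i (dur i))).foldl (fun g f => f ∘ g) id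

/-- `‖Φ − Ψ‖_{C^ℓ(K)} < ε`: all iterated derivatives of the difference up to order `ℓ`
are smaller than `ε` on `K`. -/
def CloseCl {d : ℕ} (ℓ : ℕ) (K : Set (Phase d)) (ε : ℝ) (Φ Ψ : Phase d → Phase d) : Prop :=
  ∀ j ≤ ℓ, ∀ x ∈ K, ‖iteratedFDeriv ℝ j (fun y => Φ y - Ψ y) x‖ < ε

/-- `Ψ ∈ R̄_st`: the diffeomorphism `Ψ` is small-time approximately reachable for the
control system with controlled Hamiltonians `Ham u`, `u ∈ U`. -/
def SmallTimeReachable {d : ℕ} {U : Type*} (Ham : U → Phase d → ℝ)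
    (Ψ : Phase d → Phase d) : Prop :=
  ∀ ε > 0, ∀ K : Set (Phase d), IsCompact K → ∀ ℓ : ℕ,
    ∃ τ ∈ Set.Icc (0:ℝ) ε, ∃ Φ, Reachable Ham τ Φ ∧ CloseCl ℓ K ε Φ Ψ

/-- A function `f` with complete Hamiltonian vector field is STAR (small-time approximately
reachable) if its flow at every time `s ∈ ℝ` belongs to `R̄_st`. -/
def IsSTAR {d : ℕ} {U : Type*} (Ham : U → Phase d → ℝ) (f : Phase d → ℝ) : Prop :=
  (∃ φ, IsFlowOf (hamVF f) φ) ∧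
  ∀ φ, IsFlowOf (hamVF f) φ → ∀ s : ℝ, SmallTimeReachable Ham (φ s)

/-- The Poisson bracket `{f,g} = Σ_j (∂_{p_j} f ∂_{q_j} g − ∂_{q_j} f ∂_{p_j} g)`. -/
def poissonBracket {d : ℕ} (f g : Phase d → ℝ) : Phase d → ℝ :=
  fun x => ∑ j, (fderiv ℝ f x (0, Pi.single j 1) * fderiv ℝ g x (Pi.single j 1, 0)
      - fderiv ℝ f x (Pi.single j 1, 0) * fderiv ℝ g x (0, Pi.single j 1))

/-- The mechanical Hamiltonian `H_u(q,p) = |p|²/2 + V_0(q) + Σ_j u_j V_j(q)`. -/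
def mechHam {d m : ℕ} (V0 : (Fin d → ℝ) → ℝ) (V : Fin m → (Fin d → ℝ) → ℝ)
    (u : Fin m → ℝ) : Phase d → ℝ :=
  fun x => (∑ i, (x.2 i) ^ 2) / 2 + V0 x.1 + ∑ j, u j * V j x.1

/-- The Euclidean controlled Hamiltonian
`H_u(q,p) = |p|²/2 + V_0(q) + Σ_{j=1}^d u_j q_j + u_{d+1} e^{−|q|²/2}`,
with control `u ∈ ℝ^d × ℝ ≃ ℝ^{d+1}`. -/
def eucHam {d : ℕ} (V0 : (Fin d → ℝ) → ℝ) (u : (Fin d → ℝ) × ℝ) : Phase d → ℝ :=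
  fun x => (∑ i, (x.2 i) ^ 2) / 2 + V0 x.1 + (∑ j, u.1 j * x.1 j)
    + u.2 * Real.exp (-(∑ i, (x.1 i) ^ 2) / 2)

/-- The frequencies `k_1 = e_1, …, k_{d−1} = e_{d−1}, k_d = (1,…,1)`. -/
def kvec (d : ℕ) (j : Fin d) : Fin d → ℝ :=
  if (j : ℕ) < d - 1 then Pi.single j 1 else fun _ => 1

/-- The torus controlled Hamiltonian (lifted to `ℝ^d × ℝ^d`)
`H_u(q,p) = |p|²/2 + V_0(q) + Σ_{j=1}^d (u_{2j−1} cos(k_j·q) + u_{2j} sin(k_j·q))`,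
with control `u ∈ (ℝ²)^d ≃ ℝ^{2d}`. -/
def torusHam {d : ℕ} (V0 : (Fin d → ℝ) → ℝ) (u : Fin d → ℝ × ℝ) : Phase d → ℝ :=
  fun x => (∑ i, (x.2 i) ^ 2) / 2 + V0 x.1 +
    ∑ j, ((u j).1 * Real.cos (∑ i, kvec d j i * x.1 i) +
          (u j).2 * Real.sin (∑ i, kvec d j i * x.1 i))

/-- The vertical shear `(q,p) ↦ (q, p − ∇f(q))`. -/
def vshear {d : ℕ} (f : (Fin d → ℝ) → ℝ) : Phase d → Phase d :=
  fun x => (x.1, fun i => x.2 i - fderiv ℝ f x.1 (Pi.single i 1))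

/-- The horizontal shear `(q,p) ↦ (q + ∇g(p), p)`. -/
def hshear {d : ℕ} (g : (Fin d → ℝ) → ℝ) : Phase d → Phase d :=
  fun x => (fun i => x.1 i + fderiv ℝ g x.2 (Pi.single i 1), x.2)

/-- `M` is a mesh of size `h`: the closed sup-norm cubes `C̄(m_n,h)` cover `ℝ^{2d}` and the
open cubes `C(m_n,h)` are pairwise disjoint. -/
def IsMesh {d : ℕ} (h : ℝ) (M : ℕ → Phase d) : Prop :=
  (∀ x : Phase d, ∃ n, ‖x - M n‖ ≤ h) ∧
  ∀ n ℓ : ℕ, n ≠ ℓ →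
    Disjoint {x : Phase d | ‖x - M n‖ < h} {x : Phase d | ‖x - M ℓ‖ < h}

/-- `F` is a permutation of the mesh `M` of size `h`: a bijection translating every open
cube of the mesh onto another one. -/
def IsMeshPermutation {d : ℕ} (h : ℝ) (M : ℕ → Phase d) (F : Phase d → Phase d) : Prop :=
  Function.Bijective F ∧
  ∀ n : ℕ, ∃ ℓ : ℕ, ∀ x : Phase d, ‖x - M n‖ < h → F x = x + (M ℓ - M n)

/-- The fundamental domain `Q = [0,2π)^d × ℝ^d` of `T*𝕋^d` in `ℝ^d × ℝ^d`. -/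
def torusBlock (d : ℕ) : Set (Phase d) :=
  {x : Phase d | ∀ i, 0 ≤ x.1 i ∧ x.1 i < 2 * Real.pi}

/-- A torus density of class `L^r`: a measurable function on `ℝ^d × ℝ^d`, `2π`-periodic in
each position variable, with finite `L^r` norm on the fundamental domain `Q`. -/
def IsTorusDensity {d : ℕ} (p : ENNReal) (ρ : Phase d → ℝ) : Prop :=
  Measurable ρ ∧
  (∀ (q : Fin d → ℝ) (pp : Fin d → ℝ) (k : Fin d → ℤ),
    ρ (fun i => q i + 2 * Real.pi * (k i), pp) = ρ (q, pp)) ∧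
  eLpNorm ρ p (volume.restrict (torusBlock d)) < ⊤

end
open Filter Topology
open scoped ContDiff

/-! ### Tangent functor and smooth convergence -/

/-- Tangent map. -/
noncomputable def Tan {E F : Type} [NormedAddCommGroup E] [NormedSpace ℝ E]
    [NormedAddCommGroup F] [NormedSpace ℝ F] (f : E → F) : E × E → F × F :=
  fun p => (f p.1, fderiv ℝ f p.1 p.2)

/-- `C^k` convergence (uniform on compacts), phrased with iterated tangent maps. -/
def CV {ι : Type} (l : Filter ι) : ℕ → ∀ (E F : Type) [NormedAddCommGroup E] [NormedSpace ℝ E]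
    [NormedAddCommGroup F] [NormedSpace ℝ F], (ι → E → F) → (E → F) → Prop
  | 0, E, _, _, _, _, _, G, g =>
      ∀ x0, Tendsto (fun p : ι × E => G p.1 p.2) (l ×ˢ 𝓝 x0) (𝓝 (g x0))
  | k + 1, E, F, _, _, _, _, G, g => CV l k (E × E) (F × F) (fun i => Tan (G i)) (Tan g)

section basics
variable {ι : Type} {l : Filter ι}
variable {E F G' : Type} [NormedAddCommGroup E] [NormedSpace ℝ E]
    [NormedAddCommGroup F] [NormedSpace ℝ F] [NormedAddCommGroup G'] [NormedSpace ℝ G']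

lemma Tan_smooth {f : E → F} (hf : ContDiff ℝ ∞ f) : ContDiff ℝ ∞ (Tan f) := by
  unfold Tan
  have h1 : ContDiff ℝ ∞ (fderiv ℝ f) := hf.fderiv_right (by simp)
  fun_prop

lemma smooth_diff {f : E → F} (hf : ContDiff ℝ ∞ f) : Differentiable ℝ f :=
  hf.differentiable (by simp)

lemma Tan_comp {g : F → G'} {f : E → F} (hg : Differentiable ℝ g) (hf : Differentiable ℝ f) :
    Tan (fun x => g (f x)) = fun p => Tan g (Tan f p) := by
  funext p
  have : fderiv ℝ (fun x => g (f x)) p.1 = (fderiv ℝ g (f p.1)).comp (fderiv ℝ f p.1) :=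
    fderiv_comp p.1 (hg _) (hf _)
  simp [Tan, this]

lemma Tan_add {g f : E → F} (hg : Differentiable ℝ g) (hf : Differentiable ℝ f) :
    Tan (fun x => g x + f x) = fun p => Tan g p + Tan f p := by
  funext p
  simp [Tan, fderiv_fun_add (hg p.1) (hf p.1)]

lemma Tan_sub {g f : E → F} (hg : Differentiable ℝ g) (hf : Differentiable ℝ f) :
    Tan (fun x => g x - f x) = fun p => Tan g p - Tan f p := by
  funext p
  simp [Tan, fderiv_fun_sub (hg p.1) (hf p.1)]

lemma Tan_smul {f : E → F} (c : ℝ) (hf : Differentiable ℝ f) :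
    Tan (fun x => c • f x) = fun p => c • Tan f p := by
  funext p
  simp [Tan, fderiv_fun_const_smul (hf p.1)]

lemma Tan_id : Tan (fun x : E => x) = fun p => p := by
  funext p
  simp [Tan]

lemma Tan_zero : Tan (fun _ : E => (0 : F)) = fun _ => 0 := by
  funext p
  simp [Tan]

end basics

lemma CV_const {ι : Type} (l : Filter ι) (k : ℕ) :
    ∀ (E F : Type) [NormedAddCommGroup E] [NormedSpace ℝ E]
    [NormedAddCommGroup F] [NormedSpace ℝ F] (g : E → F), ContDiff ℝ ∞ g →
    CV l k E F (fun _ => g) g := by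
  induction k with
  | zero =>
    intro E F _ _ _ _ g hg x0
    exact (hg.continuous.tendsto x0).comp tendsto_snd
  | succ k ih =>
    intro E F _ _ _ _ g hg
    exact ih _ _ _ (Tan_smooth hg)

lemma CV_comp {ι : Type} (l : Filter ι) (k : ℕ) :
    ∀ (E F H : Type) [NormedAddCommGroup E] [NormedSpace ℝ E]
    [NormedAddCommGroup F] [NormedSpace ℝ F] [NormedAddCommGroup H] [NormedSpace ℝ H]
    (A : ι → F → H) (a : F → H) (B : ι → E → F) (b : E → F),
    (∀ i, ContDiff ℝ ∞ (A i)) → ContDiff ℝ ∞ a → (∀ i, ContDiff ℝ ∞ (B i)) → ContDiff ℝ ∞ b →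
    CV l k F H A a → CV l k E F B b → CV l k E H (fun i x => A i (B i x)) (fun x => a (b x)) := by
  induction k with
  | zero =>
    intro E F H _ _ _ _ _ _ A a B b _ _ _ _ hA hB x0
    exact (hA (b x0)).comp (tendsto_fst.prodMk (hB x0))
  | succ k ih =>
    intro E F H _ _ _ _ _ _ A a B b sA sa sB sb hA hB
    have := ih _ _ _ _ _ _ _ (fun i => Tan_smooth (sA i)) (Tan_smooth sa)
      (fun i => Tan_smooth (sB i)) (Tan_smooth sb) hA hB
    simp only [CV]
    rw [Tan_comp (smooth_diff sa) (smooth_diff sb)]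
    simp_rw [fun i => Tan_comp (smooth_diff (sA i)) (smooth_diff (sB i))]
    exact this

lemma CV_add {ι : Type} (l : Filter ι) (k : ℕ) :
    ∀ (E F : Type) [NormedAddCommGroup E] [NormedSpace ℝ E]
    [NormedAddCommGroup F] [NormedSpace ℝ F]
    (A : ι → E → F) (a : E → F) (B : ι → E → F) (b : E → F),
    (∀ i, ContDiff ℝ ∞ (A i)) → ContDiff ℝ ∞ a → (∀ i, ContDiff ℝ ∞ (B i)) → ContDiff ℝ ∞ b →
    CV l k E F A a → CV l k E F B b → CV l k E F (fun i x => A i x + B i x)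
      (fun x => a x + b x) := by
  induction k with
  | zero =>
    intro E F _ _ _ _ A a B b _ _ _ _ hA hB x0
    exact (hA x0).add (hB x0)
  | succ k ih =>
    intro E F _ _ _ _ A a B b sA sa sB sb hA hB
    have := ih _ _ _ _ _ _ (fun i => Tan_smooth (sA i)) (Tan_smooth sa)
      (fun i => Tan_smooth (sB i)) (Tan_smooth sb) hA hB
    simp only [CV]
    rw [Tan_add (smooth_diff sa) (smooth_diff sb)]
    simp_rw [fun i => Tan_add (smooth_diff (sA i)) (smooth_diff (sB i))]
    exact this

lemma CV_sub {ι : Type} (l : Filter ι) (k : ℕ) :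
    ∀ (E F : Type) [NormedAddCommGroup E] [NormedSpace ℝ E]
    [NormedAddCommGroup F] [NormedSpace ℝ F]
    (A : ι → E → F) (a : E → F) (B : ι → E → F) (b : E → F),
    (∀ i, ContDiff ℝ ∞ (A i)) → ContDiff ℝ ∞ a → (∀ i, ContDiff ℝ ∞ (B i)) → ContDiff ℝ ∞ b →
    CV l k E F A a → CV l k E F B b → CV l k E F (fun i x => A i x - B i x)
      (fun x => a x - b x) := by
  induction k with
  | zero =>
    intro E F _ _ _ _ A a B b _ _ _ _ hA hB x0
    exact (hA x0).sub (hB x0)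
  | succ k ih =>
    intro E F _ _ _ _ A a B b sA sa sB sb hA hB
    have := ih _ _ _ _ _ _ (fun i => Tan_smooth (sA i)) (Tan_smooth sa)
      (fun i => Tan_smooth (sB i)) (Tan_smooth sb) hA hB
    simp only [CV]
    rw [Tan_sub (smooth_diff sa) (smooth_diff sb)]
    simp_rw [fun i => Tan_sub (smooth_diff (sA i)) (smooth_diff (sB i))]
    exact this

lemma CV_smul {ι : Type} (l : Filter ι) (k : ℕ) (c : ι → ℝ) (c0 : ℝ)
    (hc : Tendsto c l (𝓝 c0)) :
    ∀ (E F : Type) [NormedAddCommGroup E] [NormedSpace ℝ E]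
    [NormedAddCommGroup F] [NormedSpace ℝ F]
    (A : ι → E → F) (a : E → F),
    (∀ i, ContDiff ℝ ∞ (A i)) → ContDiff ℝ ∞ a →
    CV l k E F A a → CV l k E F (fun i x => c i • A i x) (fun x => c0 • a x) := by
  induction k with
  | zero =>
    intro E F _ _ _ _ A a _ _ hA x0
    exact (hc.comp tendsto_fst).smul (hA x0)
  | succ k ih =>
    intro E F _ _ _ _ A a sA sa hA
    have := ih _ _ _ _ (fun i => Tan_smooth (sA i)) (Tan_smooth sa) hA
    simp only [CV]
    rw [Tan_smul _ (smooth_diff sa)]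
    simp_rw [fun i => Tan_smul (c i) (smooth_diff (sA i))]
    exact this

/-- Compactness: local eventual statements become uniform. -/
lemma compact_ev {ι X : Type*} [TopologicalSpace X] {l : Filter ι} {K : Set X} (hK : IsCompact K)
    {P : ι → X → Prop} (h : ∀ y ∈ K, ∀ᶠ z in l ×ˢ 𝓝 y, P z.1 z.2) :
    ∀ᶠ i in l, ∀ y ∈ K, P i y := by
  refine hK.induction_on (p := fun s => ∀ᶠ i in l, ∀ y ∈ s, P i y) ?_ ?_ ?_ ?_
  · simp
  · intro s t hst ht
    filter_upwards [ht] with i hi y hy using hi y (hst hy)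
  · intro s t hs ht
    filter_upwards [hs, ht] with i hi hi' y hy
    rcases hy with hy | hy
    exacts [hi y hy, hi' y hy]
  · intro x hx
    obtain ⟨p, hp, q, hq, hpq⟩ := eventually_prod_iff.1 (h x hx)
    exact ⟨_, mem_nhdsWithin_of_mem_nhds hq, by
      filter_upwards [hp] with i hi y hy using hpq hi hy⟩

lemma CV0_cont {ι : Type} {l : Filter ι} [NeBot l] {E F : Type} [NormedAddCommGroup E]
    [NormedSpace ℝ E] [NormedAddCommGroup F] [NormedSpace ℝ F] {G : ι → E → F} {g : E → F}
    (h : CV l 0 E F G g) : Continuous g := by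
  rw [continuous_iff_continuousAt]
  intro x0
  rw [ContinuousAt, Metric.tendsto_nhds]
  intro ε hε
  have h1 := (Metric.tendsto_nhds.1 (h x0)) (ε / 2) (by positivity)
  obtain ⟨p, hp, q, hq, hpq⟩ := eventually_prod_iff.1 h1
  filter_upwards [hq] with x hx
  have h2 : Tendsto (fun i => G i x) l (𝓝 (g x)) :=
    (h x).comp (tendsto_id.prodMk (tendsto_const_nhds))
  have h3 : dist (g x) (g x0) ≤ ε / 2 := by
    refine le_of_tendsto (h2.dist tendsto_const_nhds) ?_
    filter_upwards [hp] with i hi using (hpq hi hx).le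
  linarith

/-- uniform convergence on compacts -/
lemma CV0_unif {ι : Type} {l : Filter ι} {E F : Type} [NormedAddCommGroup E]
    [NormedSpace ℝ E] [NormedAddCommGroup F] [NormedSpace ℝ F] {G : ι → E → F} {g : E → F}
    (h : CV l 0 E F G g) (hg : Continuous g) {K : Set E} (hK : IsCompact K) {ε : ℝ} (hε : 0 < ε) :
    ∀ᶠ i in l, ∀ x ∈ K, ‖G i x - g x‖ < ε := by
  apply compact_ev hK (P := fun i x => ‖G i x - g x‖ < ε)
  intro y _
  have h1 : Tendsto (fun p : ι × E => ‖G p.1 p.2 - g p.2‖) (l ×ˢ 𝓝 y) (𝓝 ‖g y - g y‖) :=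
    ((h y).sub ((hg.tendsto y).comp tendsto_snd)).norm
  rw [sub_self, norm_zero] at h1
  exact h1.eventually (gt_mem_nhds hε)

/-- converse -/
lemma CV0_of_unif {ι : Type} {l : Filter ι} {E F : Type} [NormedAddCommGroup E]
    [NormedSpace ℝ E] [NormedAddCommGroup F] [NormedSpace ℝ F] [ProperSpace E]
    {G : ι → E → F} {g : E → F} (hg : Continuous g)
    (h : ∀ K : Set E, IsCompact K → ∀ ε > 0, ∀ᶠ i in l, ∀ x ∈ K, ‖G i x - g x‖ < ε) :
    CV l 0 E F G g := by
  intro x0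
  have h1 : Tendsto (fun p : ι × E => G p.1 p.2 - g p.2) (l ×ˢ 𝓝 x0) (𝓝 0) := by
    rw [NormedAddGroup.tendsto_nhds_zero]
    intro ε hε
    refine eventually_prod_iff.2 ⟨_, h _ (isCompact_closedBall x0 1) ε hε,
      fun x => x ∈ Metric.closedBall x0 1, Metric.closedBall_mem_nhds _ one_pos, ?_⟩
    intro i hi x hx
    exact hi x hx
  have h2 := h1.add ((hg.tendsto x0).comp tendsto_snd)
  simpa using h2

lemma CV_curry (k : ℕ) :
    ∀ (E F : Type) [NormedAddCommGroup E] [NormedSpace ℝ E] [ProperSpace E]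
    [NormedAddCommGroup F] [NormedSpace ℝ F]
    (A : ℕ → ℕ → E → F) (X : ℕ → E → F) (Y : E → F),
    (∀ N, ContDiff ℝ ∞ (X N)) → ContDiff ℝ ∞ Y →
    (∀ N, CV atTop k E F (A N) (X N)) → CV atTop k E F X Y →
    CV ((atTop : Filter ℕ).curry (atTop : Filter ℕ)) k E F (fun p => A p.1 p.2) Y := by
  induction k with
  | zero =>
    intro E F _ _ _ _ _ A X Y sX sY hA hX
    apply CV0_of_unif sY.continuous
    intro K hK ε hε
    rw [eventually_curry_iff]
    filter_upwards [CV0_unif hX sY.continuous hK (half_pos hε)] with N hN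
    filter_upwards [CV0_unif (hA N) (sX N).continuous hK (half_pos hε)] with n hn x hx
    calc ‖A N n x - Y x‖ = ‖(A N n x - X N x) + (X N x - Y x)‖ := by abel_nf
      _ ≤ _ := norm_add_le _ _
      _ < ε := by linarith [hN x hx, hn x hx]
  | succ k ih =>
    intro E F _ _ _ _ _ A X Y sX sY hA hX
    exact ih _ _ _ _ _ (fun N => Tan_smooth (sX N)) (Tan_smooth sY) hA hX

open Filter Topology
open scoped ContDiff

/-! ### Convergence of one-step methods -/

lemma euler_det {F : Type} [NormedAddCommGroup F] [NormedSpace ℝ F]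
    (Y : F → F) (γ : ℝ → F) (hγ : ∀ t ∈ Set.Icc (0:ℝ) 1,
      HasDerivWithinAt γ (Y (γ t)) (Set.Icc (0:ℝ) 1) t)
    (R : ℝ) (hR : ∀ t ∈ Set.Icc (0:ℝ) 1, ‖γ t‖ ≤ R)
    (L : NNReal) (hL : LipschitzOnWith L Y (Metric.closedBall 0 (R + 1)))
    (ε : ℝ) (hε : 0 < ε) (hε1 : 3 * ε * Real.exp L ≤ 1)
    (n : ℕ) (hn : 0 < n)
    (hmod : ∀ s ∈ Set.Icc (0:ℝ) 1, ∀ t ∈ Set.Icc (0:ℝ) 1, |s - t| ≤ (1 / n : ℝ) →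
      ‖Y (γ s) - Y (γ t)‖ ≤ ε)
    (A : F → F) (hA : ∀ x ∈ Metric.closedBall (0 : F) (R + 1), ‖A x - Y x‖ ≤ ε)
    (x : F) (hx : ‖x - γ 0‖ ≤ ε) :
    ‖(fun y => y + (1 / n : ℝ) • A y)^[n] x - γ 1‖ ≤ 3 * ε * Real.exp L := by
  set h : ℝ := 1 / n with hh
  have hn' : (0 : ℝ) < n := by exact_mod_cast hn
  have hnh : n * h = 1 := by rw [hh]; field_simp
  have hpos : 0 < h := by positivity
  have hexp : ∀ k : ℕ, k ≤ n → (1 + L * h) ^ k ≤ Real.exp L := by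
    intro k hk
    have hk' : (k : ℝ) ≤ n := by exact_mod_cast hk
    calc (1 + L * h) ^ k ≤ (Real.exp (L * h)) ^ k := by
          gcongr
          linarith [Real.add_one_le_exp (L * h)]
      _ = Real.exp (k * (L * h)) := by rw [← Real.exp_nat_mul]
      _ ≤ Real.exp L := by
          apply Real.exp_le_exp.2
          have : (k : ℝ) * h ≤ 1 := by rw [← hnh]; gcongr
          nlinarith [L.2, this]
  have key : ∀ k : ℕ, k ≤ n →
      ‖(fun y => y + h • A y)^[k] x - γ (k * h)‖ ≤ (ε + k * (2 * ε * h)) * (1 + L * h) ^ k := by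
    intro k
    induction k with
    | zero => intro _; simpa using hx
    | succ k ih =>
      intro hk
      have ih' := ih (by omega)
      have hkn : (k : ℝ) + 1 ≤ n := by exact_mod_cast hk
      have ht0 : (k : ℝ) * h ∈ Set.Icc (0:ℝ) 1 := ⟨by positivity, by nlinarith⟩
      have ht1 : ((k + 1 : ℕ) : ℝ) * h ∈ Set.Icc (0:ℝ) 1 :=
        ⟨by positivity, by push_cast; nlinarith⟩
      set z := (fun y => y + h • A y)^[k] x with hz
      have hbd : (ε + k * (2 * ε * h)) * (1 + L * h) ^ k ≤ 3 * ε * Real.exp L := by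
        have : (k : ℝ) * h ≤ 1 := ht0.2
        have h1 : ε + k * (2 * ε * h) ≤ 3 * ε := by nlinarith
        gcongr
        exact hexp k (by omega)
      have hz1 : ‖z - γ (k * h)‖ ≤ 1 := ih'.trans (hbd.trans hε1)
      have hzM : z ∈ Metric.closedBall (0 : F) (R + 1) := by
        rw [mem_closedBall_zero_iff]
        calc ‖z‖ = ‖(z - γ (k * h)) + γ (k * h)‖ := by simp
          _ ≤ ‖z - γ (k * h)‖ + ‖γ (k * h)‖ := norm_add_le _ _
          _ ≤ R + 1 := by linarith [hR _ ht0]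
      have hγM : γ (k * h) ∈ Metric.closedBall (0 : F) (R + 1) := by
        rw [mem_closedBall_zero_iff]
        linarith [hR _ ht0]
      have hlip : ‖Y z - Y (γ (k * h))‖ ≤ L * ‖z - γ (k * h)‖ := by
        have := hL.dist_le_mul _ hzM _ hγM
        rwa [dist_eq_norm, dist_eq_norm] at this
      have hcurve : ‖γ ((k + 1 : ℕ) * h) - γ (k * h) - h • Y (γ (k * h))‖ ≤ ε * h := by
        set c := Y (γ (k * h)) with hc
        have hsub : Set.Icc ((k : ℝ) * h) ((k + 1 : ℕ) * h) ⊆ Set.Icc (0:ℝ) 1 :=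
          Set.Icc_subset_Icc ht0.1 ht1.2
        have hle : (k : ℝ) * h ≤ (k + 1 : ℕ) * h := by push_cast; nlinarith
        have := Convex.norm_image_sub_le_of_norm_hasDerivWithin_le
          (f := fun s => γ s - s • c) (f' := fun s => Y (γ s) - (1 : ℝ) • c)
          (s := Set.Icc ((k : ℝ) * h) ((k + 1 : ℕ) * h)) (C := ε)
          (x := (k : ℝ) * h) (y := (k + 1 : ℕ) * h)
          (fun s hs => ((hγ s (hsub hs)).mono hsub).sub
            ((hasDerivWithinAt_id s _).smul_const c))
          (fun s hs => by
            rw [one_smul]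
            refine hmod s (hsub hs) _ ht0 ?_
            have h1 := hs.1
            have h2 := hs.2
            push_cast at h2
            rw [abs_le]
            constructor <;> linarith)
          (convex_Icc _ _) ⟨le_refl _, hle⟩ ⟨hle, le_refl _⟩
        have e1 : ‖((k + 1 : ℕ) : ℝ) * h - k * h‖ = h := by
          push_cast
          rw [show ((k : ℝ) + 1) * h - k * h = h by ring, Real.norm_of_nonneg hpos.le]
        rw [e1] at this
        have e2 : γ ((k + 1 : ℕ) * h) - γ (k * h) - h • c =
          (γ ((k + 1 : ℕ) * h) - (((k + 1 : ℕ) : ℝ) * h) • c) - (γ (k * h) - ((k : ℝ) * h) • c) := by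
          push_cast
          rw [add_mul, add_smul, one_mul]
          abel
        rw [e2]
        exact this
      rw [Function.iterate_succ_apply', ← hz]
      have e3 : z + h • A z - γ ((k + 1 : ℕ) * h) = (z - γ (k * h)) + h • (A z - Y z)
          + h • (Y z - Y (γ (k * h)))
          - (γ ((k + 1 : ℕ) * h) - γ (k * h) - h • Y (γ (k * h))) := by
        simp only [smul_sub]
        abel
      have n1 : ‖h • (A z - Y z)‖ ≤ h * ε := by
        rw [norm_smul, Real.norm_of_nonneg hpos.le]
        gcongr
        exact hA z hzM
      have n2 : ‖h • (Y z - Y (γ (k * h)))‖ ≤ h * (L * ‖z - γ (k * h)‖) := by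
        rw [norm_smul, Real.norm_of_nonneg hpos.le]
        gcongr
      have hge : (1 : ℝ) ≤ (1 + L * h) ^ (k + 1) :=
        one_le_pow₀ (by have := L.2; nlinarith [mul_nonneg L.2 hpos.le])
      calc ‖z + h • A z - γ ((k + 1 : ℕ) * h)‖
          ≤ ‖z - γ (k * h)‖ + h * ε + h * (L * ‖z - γ (k * h)‖) + ε * h := by
            rw [e3]
            refine (norm_sub_le _ _).trans ?_
            have := norm_add_le ((z - γ (k * h)) + h • (A z - Y z)) (h • (Y z - Y (γ (k * h))))
            have := norm_add_le (z - γ (k * h)) (h • (A z - Y z))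
            linarith
        _ = (1 + L * h) * ‖z - γ (k * h)‖ + 2 * ε * h := by ring
        _ ≤ (1 + L * h) * ((ε + k * (2 * ε * h)) * (1 + L * h) ^ k)
              + 2 * ε * h * (1 + L * h) ^ (k + 1) := by
            have := mul_nonneg L.2 hpos.le
            have h5 : 0 ≤ 2 * ε * h := by positivity
            have : 0 ≤ 1 + (L : ℝ) * h := by positivity
            exact add_le_add (mul_le_mul_of_nonneg_left ih' this) (le_mul_of_one_le_right h5 hge)
        _ = (ε + (k + 1 : ℕ) * (2 * ε * h)) * (1 + L * h) ^ (k + 1) := by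
            push_cast
            ring
  have := key n le_rfl
  rw [hnh] at this
  refine this.trans ?_
  have h2 : ε + n * (2 * ε * h) = 3 * ε := by linear_combination 2 * ε * hnh
  rw [h2]
  gcongr
  exact hexp n le_rfl

lemma euler_limit {ι : Type} {l : Filter ι} {F : Type} [NormedAddCommGroup F] [NormedSpace ℝ F]
    [FiniteDimensional ℝ F] (Y : F → F) (hY : ContDiff ℝ ∞ Y) (γ : ℝ → F)
    (hγ : ∀ t ∈ Set.Icc (0:ℝ) 1, HasDerivWithinAt γ (Y (γ t)) (Set.Icc (0:ℝ) 1) t)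
    (a : ι → F → F) (ha : CV l 0 F F a Y) (n : ι → ℕ) (hn : Tendsto n l atTop) :
    Tendsto (fun p : ι × F => (fun y => y + (1 / n p.1 : ℝ) • a p.1 y)^[n p.1] p.2)
      (l ×ˢ 𝓝 (γ 0)) (𝓝 (γ 1)) := by
  have : ProperSpace F := FiniteDimensional.proper ℝ F
  rw [Metric.tendsto_nhds]
  intro η hη
  have hγc : ContinuousOn γ (Set.Icc 0 1) := fun t ht => (hγ t ht).continuousWithinAt
  obtain ⟨R, hR⟩ := isCompact_Icc.exists_bound_of_continuousOn hγc
  obtain ⟨L, hL⟩ := (hY.contDiffOn (s := Metric.closedBall 0 (R + 1))).exists_lipschitzOnWith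
    (by simp) (convex_closedBall _ _) (isCompact_closedBall _ _)
  set C := Real.exp L with hC
  have hCpos : 0 < C := Real.exp_pos _
  set ε := min η 1 / (4 * C) with hεd
  have hmin : 0 < min η 1 := lt_min hη one_pos
  have hε : 0 < ε := by positivity
  have hεC : 3 * ε * C < min η 1 := by
    have : 4 * (ε * C) = min η 1 := by rw [hεd]; field_simp
    nlinarith [mul_pos hε hCpos]
  have huc := isCompact_Icc.uniformContinuousOn_of_continuous (hY.continuous.comp_continuousOn hγc)
  obtain ⟨δ, hδ, hδ'⟩ := Metric.uniformContinuousOn_iff.1 huc ε hε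
  have ev1 := CV0_unif ha hY.continuous (isCompact_closedBall (0 : F) (R + 1)) hε
  have ev2 : ∀ᶠ i in l, (1 / n i : ℝ) < δ :=
    ((tendsto_const_div_atTop_nhds_zero_nat (1 : ℝ)).comp hn).eventually (gt_mem_nhds hδ)
  have ev3 : ∀ᶠ i in l, 0 < n i := hn.eventually (eventually_gt_atTop 0)
  refine eventually_prod_iff.2 ⟨_, (ev1.and (ev2.and ev3)), fun x => x ∈ Metric.ball (γ 0) ε,
    Metric.ball_mem_nhds _ hε, ?_⟩
  rintro i ⟨h1, h2, h3⟩ x hx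
  rw [dist_eq_norm]
  refine (euler_det Y γ hγ R hR L hL ε hε (hεC.le.trans (min_le_right _ _)) (n i) h3 ?_ (a i)
    (fun x hx => (h1 x hx).le) x ?_).trans_lt (hεC.trans_le (min_le_left _ _))
  · intro s hs t ht hst
    have := hδ' s hs t ht (by rw [Real.dist_eq]; linarith)
    rw [dist_eq_norm] at this
    exact this.le
  · rw [← dist_eq_norm]
    exact (Metric.mem_ball.1 hx).le

/-! ### Linear ODE -/

lemma linear_ode {F : Type} [NormedAddCommGroup F] [NormedSpace ℝ F] [CompleteSpace F]
    (A : ℝ → F →L[ℝ] F) (hA : ContinuousOn A (Set.Icc 0 1)) (v0 : F) :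
    ∃ v : ℝ → F, v 0 = v0 ∧ ∀ t ∈ Set.Icc (0:ℝ) 1,
      HasDerivWithinAt v (A t (v t)) (Set.Icc (0:ℝ) 1) t := by
  obtain ⟨M, hM⟩ := isCompact_Icc.exists_bound_of_continuousOn hA
  have hM0 : 0 ≤ M := (norm_nonneg _).trans (hM 0 ⟨le_rfl, zero_le_one⟩)
  obtain ⟨N, hN⟩ := exists_nat_gt (2 * M)
  have hN0 : (0 : ℝ) < N := lt_of_le_of_lt (by positivity) hN
  have key : ∀ k : ℕ, k ≤ N → ∃ v : ℝ → F, v 0 = v0 ∧ ∀ t ∈ Set.Icc (0:ℝ) (k / N),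
      HasDerivWithinAt v (A t (v t)) (Set.Icc (0:ℝ) (k / N)) t := by
    intro k
    induction k with
    | zero =>
      intro _
      refine ⟨fun _ => v0, rfl, ?_⟩
      intro t ht
      simp only [Nat.cast_zero, zero_div, Set.Icc_self, Set.mem_singleton_iff] at ht ⊢
      subst ht
      rw [← hasDerivWithinAt_diff_singleton]
      simp only [Set.diff_self]
      exact hasDerivWithinAt_iff_hasFDerivWithinAt.2 (HasFDerivWithinAt.of_notMem_closure (by simp))
    | succ k ih =>
      intro hk
      obtain ⟨v, hv0, hv⟩ := ih (by omega)
      have hkN : ((k : ℝ) + 1) ≤ N := by exact_mod_cast hk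
      set c : ℝ := k / N with hc
      set c' : ℝ := (k + 1 : ℕ) / N with hc'
      have hcc : c' - c = 1 / N := by rw [hc, hc']; push_cast; field_simp; ring
      have hNpos : 0 < 1 / (N : ℝ) := by positivity
      have hc0 : 0 ≤ c := by positivity
      have hle : c ≤ c' := by linarith
      have hc1 : c' ≤ 1 := by rw [hc', div_le_one hN0]; push_cast; exact hkN
      have hsub : Set.Icc c c' ⊆ Set.Icc (0 : ℝ) 1 := Set.Icc_subset_Icc hc0 hc1
      have hPL : IsPicardLindelof (fun t x => A t x) (tmin := c) (tmax := c')
          ⟨c, le_rfl, hle⟩ (v c) (‖v c‖₊ + 1) 0 (⟨M, hM0⟩ * (2 * ‖v c‖₊ + 1)) ⟨M, hM0⟩ := by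
        constructor
        · intro t ht
          refine LipschitzWith.lipschitzOnWith (LipschitzWith.of_dist_le_mul ?_)
          intro x y
          rw [dist_eq_norm, dist_eq_norm, ← map_sub]
          exact (A t).le_of_opNorm_le (hM t (hsub ht)) _
        · intro x _
          exact (hA.mono hsub).clm_apply continuousOn_const
        · intro t ht x hx
          rw [mem_closedBall_iff_norm] at hx
          push_cast at hx ⊢
          have h1 : ‖x‖ ≤ 2 * ‖v c‖ + 1 := by
            have := norm_le_norm_add_norm_sub' x (v c)
            linarith
          refine ((A t).le_of_opNorm_le (hM t (hsub ht)) _).trans ?_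
          change M * ‖x‖ ≤ M * (2 * ‖v c‖ + 1)
          gcongr
        · push_cast
          change M * (2 * ‖v c‖ + 1) * max (c' - c) (c - c) ≤ ‖v c‖ + 1 - 0
          rw [sub_self, hcc, max_eq_left hNpos.le, mul_one_div, div_le_iff₀ hN0]
          nlinarith [norm_nonneg (v c)]
      obtain ⟨w, hw0, hw⟩ := hPL.exists_eq_forall_mem_Icc_hasDerivWithinAt₀
      have hw0' : w c = v c := hw0
      have hun : Set.Icc 0 c' = Set.Icc 0 c ∪ Set.Icc c c' := (Set.Icc_union_Icc_eq_Icc hc0 hle).symm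
      refine ⟨fun t => if t ≤ c then v t else w t, by simp [hc0, hv0], ?_⟩
      have eqv : ∀ t ∈ Set.Icc 0 c, (if t ≤ c then v t else w t) = v t := fun t ht => by
        simp [ht.2]
      have eqw : ∀ t ∈ Set.Icc c c', (if t ≤ c then v t else w t) = w t := fun t ht => by
        by_cases h : t ≤ c
        · have : t = c := le_antisymm h ht.1
          simp [this, hw0']
        · simp [h]
      intro t ht
      rw [hun]
      apply HasDerivWithinAt.union
      · by_cases h : t ∈ Set.Icc 0 c
        · show HasDerivWithinAt _ (A t (if t ≤ c then v t else w t)) _ _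
          rw [eqv t h]
          exact (hv t h).congr eqv (eqv t h)
        · have hcl : t ∉ closure (Set.Icc 0 c) := by rw [isClosed_Icc.closure_eq]; exact h
          exact hasDerivWithinAt_iff_hasFDerivWithinAt.2 (HasFDerivWithinAt.of_notMem_closure hcl)
      · by_cases h : t ∈ Set.Icc c c'
        · show HasDerivWithinAt _ (A t (if t ≤ c then v t else w t)) _ _
          rw [eqw t h]
          exact (hw t h).congr eqw (eqw t h)
        · have hcl : t ∉ closure (Set.Icc c c') := by rw [isClosed_Icc.closure_eq]; exact h
          exact hasDerivWithinAt_iff_hasFDerivWithinAt.2 (HasFDerivWithinAt.of_notMem_closure hcl)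
  have := key N le_rfl
  rwa [div_self hN0.ne'] at this

open Filter Topology
open scoped ContDiff

/-! ### Smooth dependence and smooth convergence of one-step methods -/

/-- There is a solution of the autonomous equation on `[0,1]` from `x` to `y`. -/
def Sol {F : Type} [NormedAddCommGroup F] [NormedSpace ℝ F] (Y : F → F) (x y : F) : Prop :=
  ∃ γ : ℝ → F, γ 0 = x ∧ γ 1 = y ∧ ∀ t ∈ Set.Icc (0:ℝ) 1,
    HasDerivWithinAt γ (Y (γ t)) (Set.Icc (0:ℝ) 1) t

lemma diff_limit {ι : Type} {l : Filter ι} [NeBot l] {E F : Type} [NormedAddCommGroup E]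
    [NormedSpace ℝ E] [FiniteDimensional ℝ E] [NormedAddCommGroup F] [NormedSpace ℝ F]
    (G : ι → E → F) (hG : ∀ i, Differentiable ℝ (G i)) (ψ : E → F) (ψ2 : E × E → F)
    (h0 : ∀ x, Tendsto (fun i => G i x) l (𝓝 (ψ x)))
    (h1 : ∀ z0, Tendsto (fun p : ι × (E × E) => fderiv ℝ (G p.1) p.2.1 p.2.2)
      (l ×ˢ 𝓝 z0) (𝓝 (ψ2 z0))) (x : E) :
    ∃ A : E →L[ℝ] F, HasFDerivAt ψ A x ∧ ∀ v, A v = ψ2 (x, v) := by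
  have : ProperSpace E := FiniteDimensional.proper ℝ E
  have hpt : ∀ y v, Tendsto (fun i => fderiv ℝ (G i) y v) l (𝓝 (ψ2 (y, v))) := by
    intro y v
    exact (h1 (y, v)).comp (tendsto_id.prodMk (tendsto_const_nhds (x := (y, v))))
  have hcont : Continuous ψ2 :=
    CV0_cont (l := l) (G := fun i (z : E × E) => fderiv ℝ (G i) z.1 z.2) (g := ψ2) h1
  let A : E → E →L[ℝ] F := fun y => LinearMap.toContinuousLinearMap
    { toFun := fun v => ψ2 (y, v)
      map_add' := by
        intro v w
        refine tendsto_nhds_unique (hpt y (v + w)) ?_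
        simpa using (hpt y v).add (hpt y w)
      map_smul' := by
        intro c v
        refine tendsto_nhds_unique (hpt y (c • v)) ?_
        simpa using (hpt y v).const_smul c }
  have hA : ∀ y v, A y v = ψ2 (y, v) := fun y v => rfl
  refine ⟨A x, ?_, hA x⟩
  refine hasFDerivAt_of_tendstoUniformlyOnFilter (l := l) (f := G)
    (f' := fun i y => fderiv ℝ (G i) y) (g := ψ) (g' := A) ?_ ?_ ?_
  · rw [Metric.tendstoUniformlyOnFilter_iff]
    intro ε hε
    have key := compact_ev (l := l ×ˢ 𝓝 x) (isCompact_closedBall (0 : E) 1)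
      (P := fun q v => ‖ψ2 (q.2, v) - fderiv ℝ (G q.1) q.2 v‖ < ε / 2) (by
        intro v _
        have e1 : Tendsto (fun z : (ι × E) × E => (z.1.1, (z.1.2, z.2)))
            ((l ×ˢ 𝓝 x) ×ˢ 𝓝 v) (l ×ˢ 𝓝 (x, v)) := by
          rw [nhds_prod_eq]
          exact (tendsto_fst.comp tendsto_fst).prodMk
            ((tendsto_snd.comp tendsto_fst).prodMk tendsto_snd)
        have e2 := (h1 (x, v)).comp e1
        have e3 := ((hcont.tendsto (x, v)).comp tendsto_snd).comp e1
        have e4 := (e3.sub e2).norm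
        rw [sub_self, norm_zero] at e4
        exact e4.eventually (gt_mem_nhds (by positivity)))
    filter_upwards [key] with q hq
    rw [dist_eq_norm]
    refine lt_of_le_of_lt (ContinuousLinearMap.opNorm_le_of_unit_norm (by positivity) ?_)
      (half_lt_self hε)
    intro v hv
    exact (hq v (by simp [hv])).le
  · exact Eventually.of_forall fun p => (hG p.1 p.2).hasFDerivAt
  · exact Eventually.of_forall h0

section
variable {ι : Type} {l : Filter ι}

lemma Tan_iter {E F : Type} [NormedAddCommGroup E] [NormedSpace ℝ E]
    [NormedAddCommGroup F] [NormedSpace ℝ F] (j : E → F) (hj : ContDiff ℝ ∞ j)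
    (a : F → F) (ha : ContDiff ℝ ∞ a) (h : ℝ) (n : ℕ) :
    ContDiff ℝ ∞ (fun x => (fun y => y + h • a y)^[n] (j x)) ∧
    Tan (fun x => (fun y => y + h • a y)^[n] (j x)) =
      fun z => (fun y => y + h • Tan a y)^[n] (Tan j z) := by
  induction n with
  | zero => exact ⟨by simpa using hj, by simp⟩
  | succ n ih =>
    simp only [Function.iterate_succ_apply']
    refine ⟨ih.1.add (contDiff_const.smul (ha.comp ih.1)), ?_⟩
    have hst : ContDiff ℝ ∞ (fun y => y + h • a y) := contDiff_id.add (contDiff_const.smul ha)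
    have e1 := Tan_comp (smooth_diff hst) (smooth_diff ih.1)
    have e2 : Tan (fun y => y + h • a y) = fun z => z + h • Tan a z := by
      have e3 := Tan_add (g := fun y : F => y) (f := fun y => h • a y) differentiable_id
        (smooth_diff (contDiff_const.smul ha))
      rw [e3, Tan_smul h (smooth_diff ha), Tan_id]
    rw [e1, ih.2, e2]

lemma flow_CV0 {E F : Type} [NormedAddCommGroup E] [NormedSpace ℝ E]
    [NormedAddCommGroup F] [NormedSpace ℝ F] [FiniteDimensional ℝ F]
    (j : E → F) (hj : Continuous j) (Y : F → F) (hY : ContDiff ℝ ∞ Y)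
    (ψ : E → F) (hψ : ∀ x, Sol Y (j x) (ψ x))
    (a : ι → F → F) (ha : CV l 0 F F a Y) (n : ι → ℕ) (hn : Tendsto n l atTop) :
    CV l 0 E F (fun i x => (fun y => y + (1 / n i : ℝ) • a i y)^[n i] (j x)) ψ := by
  intro x0
  obtain ⟨γ, h0, h1, hγ⟩ := hψ x0
  have := euler_limit Y hY γ hγ a ha n hn
  rw [h0, h1] at this
  have e : Tendsto (fun p : ι × E => (p.1, j p.2)) (l ×ˢ 𝓝 x0) (l ×ˢ 𝓝 (j x0)) :=
    tendsto_fst.prodMk ((hj.tendsto x0).comp tendsto_snd)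
  have h3 := this.comp e
  simp only [Function.comp_def] at h3
  exact h3

lemma flow_tan [NeBot l] {E F : Type} [NormedAddCommGroup E] [NormedSpace ℝ E]
    [FiniteDimensional ℝ E] [NormedAddCommGroup F] [NormedSpace ℝ F] [FiniteDimensional ℝ F]
    (j : E → F) (hj : ContDiff ℝ ∞ j) (Y : F → F) (hY : ContDiff ℝ ∞ Y)
    (ψ : E → F) (hψ : ∀ x, Sol Y (j x) (ψ x))
    (a : ι → F → F) (hs : ∀ i, ContDiff ℝ ∞ (a i)) (ha : ∀ k, CV l k F F a Y)
    (n : ι → ℕ) (hn : Tendsto n l atTop) :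
    Differentiable ℝ ψ ∧ ∀ z, Sol (Tan Y) (Tan j z) (Tan ψ z) := by
  have : CompleteSpace F := FiniteDimensional.complete ℝ F
  have ex : ∀ z : E × E, ∃ w : F, Sol (Tan Y) (Tan j z) (ψ z.1, w) := by
    rintro ⟨x, v⟩
    obtain ⟨γ, h0, h1, hγ⟩ := hψ x
    have hγc : ContinuousOn γ (Set.Icc 0 1) := fun t ht => (hγ t ht).continuousWithinAt
    have hY' : ContDiff ℝ ∞ (fderiv ℝ Y) := hY.fderiv_right (by simp)
    obtain ⟨w, hw0, hw⟩ := linear_ode (fun t => fderiv ℝ Y (γ t))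
      (hY'.continuous.comp_continuousOn hγc) (fderiv ℝ j x v)
    refine ⟨w 1, fun t => (γ t, w t), by simp [Tan, h0, hw0], by simp [h1], ?_⟩
    intro t ht
    exact (hγ t ht).prodMk (hw t ht)
  choose W hW using ex
  have c1 := flow_CV0 (l := l) (Tan j) (Tan_smooth hj).continuous (Tan Y) (Tan_smooth hY)
    (fun z => (ψ z.1, W z)) hW (fun i => Tan (a i)) (ha 1) n hn
  have c0 := flow_CV0 (l := l) j hj.continuous Y hY ψ hψ a (ha 0) n hn
  have hd := diff_limit (l := l)
    (fun i x => (fun y => y + (1 / n i : ℝ) • a i y)^[n i] (j x))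
    (fun i => smooth_diff (Tan_iter j hj (a i) (hs i) _ (n i)).1) ψ W
    (fun x => by
      have e : Tendsto (fun i : ι => (i, x)) l (l ×ˢ 𝓝 x) :=
        tendsto_id.prodMk (tendsto_const_nhds (x := x))
      have h3 := (c0 x).comp e
      simp only [Function.comp_def] at h3
      exact h3)
    (by
      intro z0
      have h3 := (continuous_snd.tendsto _).comp (c1 z0)
      simp only [Function.comp_def] at h3
      have e : ∀ (i : ι) (z : E × E), fderiv ℝ
          (fun x => (fun y => y + (1 / n i : ℝ) • a i y)^[n i] (j x)) z.1 z.2 =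
          ((fun y => y + (1 / n i : ℝ) • Tan (a i) y)^[n i] (Tan j z)).2 := by
        intro i z
        have e := congrFun (Tan_iter j hj (a i) (hs i) (1 / n i : ℝ) (n i)).2 z
        rw [← e]
        rfl
      simp only [e]
      exact h3)
  refine ⟨fun x => ?_, fun z => ?_⟩
  · obtain ⟨A, hA, _⟩ := hd x
    exact hA.differentiableAt
  · obtain ⟨A, hA, hA2⟩ := hd z.1
    have : Tan ψ z = (ψ z.1, W z) := by
      simp [Tan, hA.fderiv, hA2]
    rw [this]
    exact hW z

lemma flow_CV [NeBot l] (n : ι → ℕ) (hn : Tendsto n l atTop) (k : ℕ) :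
    ∀ (E F : Type) [NormedAddCommGroup E] [NormedSpace ℝ E]
    [FiniteDimensional ℝ E] [NormedAddCommGroup F] [NormedSpace ℝ F] [FiniteDimensional ℝ F]
    (j : E → F) (_ : ContDiff ℝ ∞ j) (Y : F → F) (_ : ContDiff ℝ ∞ Y)
    (ψ : E → F) (_ : ∀ x, Sol Y (j x) (ψ x))
    (a : ι → F → F) (_ : ∀ i, ContDiff ℝ ∞ (a i)) (_ : ∀ k, CV l k F F a Y),
    CV l k E F (fun i x => (fun y => y + (1 / n i : ℝ) • a i y)^[n i] (j x)) ψ := by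
  induction k with
  | zero =>
    intro E F _ _ _ _ _ _ j hj Y hY ψ hψ a hs ha
    exact flow_CV0 j hj.continuous Y hY ψ hψ a (ha 0) n hn
  | succ k ih =>
    intro E F _ _ _ _ _ _ j hj Y hY ψ hψ a hs ha
    have h1 := flow_tan (l := l) j hj Y hY ψ hψ a hs ha n hn
    have := ih (E × E) (F × F) (Tan j) (Tan_smooth hj) (Tan Y) (Tan_smooth hY) (Tan ψ) h1.2
      (fun i => Tan (a i)) (fun i => Tan_smooth (hs i)) (fun k => ha (k + 1))
    unfold CV
    refine Eq.mp ?_ this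
    congr 1
    funext i
    exact (Tan_iter j hj (a i) (hs i) _ (n i)).2.symm

lemma flow_smooth_aux (k : ℕ) :
    ∀ (E F : Type) [NormedAddCommGroup E] [NormedSpace ℝ E]
    [FiniteDimensional ℝ E] [NormedAddCommGroup F] [NormedSpace ℝ F] [FiniteDimensional ℝ F]
    (j : E → F) (_ : ContDiff ℝ ∞ j) (Y : F → F) (_ : ContDiff ℝ ∞ Y)
    (ψ : E → F) (_ : ∀ x, Sol Y (j x) (ψ x)), ContDiff ℝ k ψ := by
  induction k with
  | zero =>
    intro E F _ _ _ _ _ _ j hj Y hY ψ hψ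
    have := CV0_cont (flow_CV0 (l := atTop) j hj.continuous Y hY ψ hψ (fun _ => Y)
      (CV_const _ 0 F F Y hY) (fun i : ℕ => i) tendsto_id)
    exact contDiff_zero.2 this
  | succ k ih =>
    intro E F _ _ _ _ _ _ j hj Y hY ψ hψ
    have h1 := flow_tan (l := atTop) j hj Y hY ψ hψ (fun _ => Y) (fun _ => hY)
      (fun k => CV_const _ k F F Y hY) (fun i : ℕ => i) tendsto_id
    have h2 := ih (E × E) (F × F) (Tan j) (Tan_smooth hj) (Tan Y) (Tan_smooth hY) (Tan ψ) h1.2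
    have e : ((k + 1 : ℕ) : WithTop ℕ∞) = (k : WithTop ℕ∞) + 1 := by norm_cast
    rw [e, contDiff_succ_iff_fderiv]
    refine ⟨h1.1, by simp, ?_⟩
    rw [contDiff_clm_apply_iff]
    intro v
    exact (contDiff_snd.comp h2).comp (contDiff_id.prodMk contDiff_const : ContDiff ℝ k (fun y : E => (y, v)))

lemma flow_smooth {E F : Type} [NormedAddCommGroup E] [NormedSpace ℝ E]
    [FiniteDimensional ℝ E] [NormedAddCommGroup F] [NormedSpace ℝ F] [FiniteDimensional ℝ F]
    (j : E → F) (hj : ContDiff ℝ ∞ j) (Y : F → F) (hY : ContDiff ℝ ∞ Y)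
    (ψ : E → F) (hψ : ∀ x, Sol Y (j x) (ψ x)) : ContDiff ℝ ∞ ψ := by
  rw [contDiff_infty]
  exact fun k => flow_smooth_aux k E F j hj Y hY ψ hψ

end

open Filter Topology
open scoped ContDiff

/-! ### Comparison with iterated derivatives -/

lemma nat_le_inf (i : ℕ) : (i : WithTop ℕ∞) ≤ ∞ := by exact_mod_cast le_top

section
variable {ι : Type} {l : Filter ι}
variable {E F G' : Type} [NormedAddCommGroup E] [NormedSpace ℝ E]
  [NormedAddCommGroup F] [NormedSpace ℝ F] [NormedAddCommGroup G'] [NormedSpace ℝ G']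

lemma iter_comp_right_le {f : E → F} (hf : ContDiff ℝ ∞ f) (L : G' →L[ℝ] E) (hL : ‖L‖ ≤ 1)
    (i : ℕ) (x : G') : ‖iteratedFDeriv ℝ i (fun y => f (L y)) x‖ ≤ ‖iteratedFDeriv ℝ i f (L x)‖ := by
  have := L.iteratedFDeriv_comp_right hf x (nat_le_inf i)
  change ‖iteratedFDeriv ℝ i (f ∘ L) x‖ ≤ _
  rw [this]
  refine (ContinuousMultilinearMap.norm_compContinuousLinearMap_le _ _).trans ?_
  refine mul_le_of_le_one_right (norm_nonneg _) ?_
  simpa using pow_le_one₀ (norm_nonneg L) hL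

lemma iter_comp_left_le {f : E → F} (hf : ContDiff ℝ ∞ f) (L : F →L[ℝ] G')
    (i : ℕ) (x : E) : ‖iteratedFDeriv ℝ i (fun y => L (f y)) x‖ ≤ ‖L‖ * ‖iteratedFDeriv ℝ i f x‖ := by
  have := L.iteratedFDeriv_comp_left (hf.contDiffAt (x := x)) (nat_le_inf i)
  change ‖iteratedFDeriv ℝ i (L ∘ f) x‖ ≤ _
  rw [this]
  exact ContinuousLinearMap.norm_compContinuousMultilinearMap_le _ _

lemma iter_succ_le_Tan {f : E → F} (hf : ContDiff ℝ ∞ f) (j : ℕ) (x : E) (C : ℝ) (hC : 0 ≤ C)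
    (h : ∀ v ∈ Metric.closedBall (0 : E) 1, ‖iteratedFDeriv ℝ j (Tan f) (x, v)‖ ≤ C) :
    ‖iteratedFDeriv ℝ (j + 1) f x‖ ≤ C := by
  rw [← norm_iteratedFDeriv_fderiv]
  have hf' : ContDiff ℝ ∞ (fderiv ℝ f) := hf.fderiv_right (by simp)
  refine ContinuousMultilinearMap.opNorm_le_bound hC fun m => ?_
  refine ContinuousLinearMap.opNorm_le_of_unit_norm (by positivity) ?_
  intro v hv
  rw [← iteratedFDeriv_clm_apply_const_apply hf' (nat_le_inf j)]
  refine (ContinuousMultilinearMap.le_opNorm _ _).trans ?_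
  gcongr
  refine le_trans ?_ (h v (by simp [hv]))
  have hT := Tan_smooth hf
  have hT2 : ContDiff ℝ ∞ (fun z : E × E => Tan f (z + (0, v))) :=
    hT.comp (contDiff_id.add contDiff_const)
  have e : (fun y => fderiv ℝ f y v) = fun y =>
      ContinuousLinearMap.snd ℝ F F (Tan f (ContinuousLinearMap.inl ℝ E E y + (0, v))) := by
    funext y
    simp [Tan]
  rw [e]
  refine (iter_comp_left_le (hT2.comp (ContinuousLinearMap.inl ℝ E E).contDiff) _ j x).trans ?_
  refine (mul_le_of_le_one_left (norm_nonneg _) (ContinuousLinearMap.norm_snd_le ℝ F F)).trans ?_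
  refine (iter_comp_right_le hT2 (ContinuousLinearMap.inl ℝ E E)
    (ContinuousLinearMap.norm_inl_le_one ℝ E E) j x).trans ?_
  rw [iteratedFDeriv_comp_add_right]
  simp

end

lemma CV_to_iter {ι : Type} {l : Filter ι} (j : ℕ) :
    ∀ (E F : Type) [NormedAddCommGroup E] [NormedSpace ℝ E]
    [FiniteDimensional ℝ E] [NormedAddCommGroup F] [NormedSpace ℝ F]
    (D : ι → E → F) (_ : ∀ i, ContDiff ℝ ∞ (D i)) (_ : ∀ k, CV l k E F D (fun _ => 0)) (x0 : E),
    Tendsto (fun p : ι × E => ‖iteratedFDeriv ℝ j (D p.1) p.2‖) (l ×ˢ 𝓝 x0) (𝓝 0) := by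
  induction j with
  | zero =>
    intro E F _ _ _ _ _ D hD hc x0
    simp only [norm_iteratedFDeriv_zero]
    have := (hc 0 x0).norm
    simpa using this
  | succ j ih =>
    intro E F _ _ _ _ _ D hD hc x0
    have : ProperSpace E := FiniteDimensional.proper ℝ E
    have h1 := ih (E × E) (F × F) (fun i => Tan (D i)) (fun i => Tan_smooth (hD i)) (by
      intro k
      have := hc (k + 1)
      unfold CV at this
      rw [Tan_zero] at this
      exact this)
    rw [Metric.tendsto_nhds]
    intro ε hε
    have key := compact_ev (l := l ×ˢ 𝓝 x0) (isCompact_closedBall (0 : E) 1)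
      (P := fun q v => ‖iteratedFDeriv ℝ j (Tan (D q.1)) (q.2, v)‖ < ε / 2) (by
        intro v _
        have e1 : Tendsto (fun z : (ι × E) × E => (z.1.1, (z.1.2, z.2)))
            ((l ×ˢ 𝓝 x0) ×ˢ 𝓝 v) (l ×ˢ 𝓝 (x0, v)) := by
          rw [nhds_prod_eq]
          exact (tendsto_fst.comp tendsto_fst).prodMk
            ((tendsto_snd.comp tendsto_fst).prodMk tendsto_snd)
        have e2 := (h1 (x0, v)).comp e1
        exact e2.eventually (gt_mem_nhds (by positivity)))
    filter_upwards [key] with q hq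
    rw [dist_zero_right, norm_norm]
    refine lt_of_le_of_lt (iter_succ_le_Tan (hD q.1) j q.2 (ε / 2) (by positivity) ?_)
      (half_lt_self hε)
    intro v hv
    exact (hq v hv).le

lemma iter_Tan_le {E F : Type} [NormedAddCommGroup E] [NormedSpace ℝ E]
    [NormedAddCommGroup F] [NormedSpace ℝ F] {f : E → F} (hf : ContDiff ℝ ∞ f) (j : ℕ) (z : E × E) :
    ‖iteratedFDeriv ℝ j (Tan f) z‖ ≤ ‖iteratedFDeriv ℝ j f z.1‖ +
      ∑ i ∈ Finset.range (j + 1), (j.choose i : ℝ) * ‖iteratedFDeriv ℝ (i + 1) f z.1‖ *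
        ‖iteratedFDeriv ℝ (j - i) (fun z : E × E => z.2) z‖ := by
  have hf' : ContDiff ℝ ∞ (fderiv ℝ f) := hf.fderiv_right (by simp)
  have hA : ContDiff ℝ ∞ (fun z : E × E => f z.1) := hf.comp contDiff_fst
  have hF : ContDiff ℝ ∞ (fun z : E × E => fderiv ℝ f z.1) := hf'.comp contDiff_fst
  have hB : ContDiff ℝ ∞ (fun z : E × E => fderiv ℝ f z.1 z.2) := hF.clm_apply contDiff_snd
  have e : iteratedFDeriv ℝ j (Tan f) z = (iteratedFDeriv ℝ j (fun z : E × E => f z.1) z).prod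
      (iteratedFDeriv ℝ j (fun z : E × E => fderiv ℝ f z.1 z.2) z) :=
    iteratedFDeriv_prodMk hA.contDiffAt hB.contDiffAt (nat_le_inf j)
  rw [e, ContinuousMultilinearMap.opNorm_prod]
  have h1 := iter_comp_right_le hf (ContinuousLinearMap.fst ℝ E E)
    (ContinuousLinearMap.norm_fst_le ℝ E E) j z
  have h2 := norm_iteratedFDeriv_clm_apply hF (contDiff_snd (𝕜 := ℝ) (E := E) (F := E)) z
    (nat_le_inf j)
  have hpos : 0 ≤ ∑ i ∈ Finset.range (j + 1), (j.choose i : ℝ) *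
      ‖iteratedFDeriv ℝ (i + 1) f z.1‖ * ‖iteratedFDeriv ℝ (j - i) (fun z : E × E => z.2) z‖ := by
    positivity
  refine max_le (h1.trans (le_add_of_nonneg_right hpos)) ?_
  refine le_trans (h2.trans ?_) (le_add_of_nonneg_left (norm_nonneg _))
  refine Finset.sum_le_sum fun i _ => ?_
  have h3 := iter_comp_right_le hf' (ContinuousLinearMap.fst ℝ E E)
    (ContinuousLinearMap.norm_fst_le ℝ E E) i z
  rw [norm_iteratedFDeriv_fderiv] at h3
  gcongr
  exact h3

lemma iter_to_CV {ι : Type} {l : Filter ι} (k : ℕ) :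
    ∀ (E F : Type) [NormedAddCommGroup E] [NormedSpace ℝ E]
    [NormedAddCommGroup F] [NormedSpace ℝ F]
    (D : ι → E → F) (_ : ∀ i, ContDiff ℝ ∞ (D i))
    (_ : ∀ j x0, Tendsto (fun p : ι × E => ‖iteratedFDeriv ℝ j (D p.1) p.2‖) (l ×ˢ 𝓝 x0) (𝓝 0)),
    CV l k E F D (fun _ => 0) := by
  induction k with
  | zero =>
    intro E F _ _ _ _ D hD h x0
    have := h 0 x0
    simp only [norm_iteratedFDeriv_zero] at this
    exact tendsto_zero_iff_norm_tendsto_zero.2 this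
  | succ k ih =>
    intro E F _ _ _ _ D hD h
    unfold CV
    rw [Tan_zero]
    refine ih _ _ _ (fun i => Tan_smooth (hD i)) ?_
    intro j z0
    have ef : Tendsto (fun p : ι × (E × E) => (p.1, p.2.1)) (l ×ˢ 𝓝 z0) (l ×ˢ 𝓝 z0.1) :=
      tendsto_fst.prodMk ((continuous_fst.tendsto z0).comp tendsto_snd)
    have es : ∀ r : ℕ, Tendsto (fun p : ι × (E × E) =>
        ‖iteratedFDeriv ℝ r (fun z : E × E => z.2) p.2‖) (l ×ˢ 𝓝 z0)
        (𝓝 ‖iteratedFDeriv ℝ r (fun z : E × E => z.2) z0‖) := by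
      intro r
      have : Continuous (iteratedFDeriv ℝ r (fun z : E × E => z.2)) :=
        (contDiff_snd (𝕜 := ℝ) (n := ∞)).continuous_iteratedFDeriv (nat_le_inf r)
      exact ((this.tendsto z0).comp tendsto_snd).norm
    refine squeeze_zero (fun _ => norm_nonneg _) (fun p => iter_Tan_le (hD p.1) j p.2) ?_
    have t0 := (h j z0.1).comp ef
    have t1 : Tendsto (fun p : ι × (E × E) => ∑ i ∈ Finset.range (j + 1),
        (j.choose i : ℝ) * ‖iteratedFDeriv ℝ (i + 1) (D p.1) p.2.1‖ *
        ‖iteratedFDeriv ℝ (j - i) (fun z : E × E => z.2) p.2‖) (l ×ˢ 𝓝 z0)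
        (𝓝 (∑ i ∈ Finset.range (j + 1), (j.choose i : ℝ) * 0 *
          ‖iteratedFDeriv ℝ (j - i) (fun z : E × E => z.2) z0‖)) := by
      refine tendsto_finsetSum _ fun i _ => ?_
      exact (((h (i + 1) z0.1).comp ef).const_mul _).mul (es (j - i))
    have t2 := t0.add t1
    simpa [Function.comp_def] using t2

/-- Uniform convergence on compact sets of all derivatives. -/
lemma CV_iff_unif {ι : Type} {l : Filter ι} {E F : Type} [NormedAddCommGroup E] [NormedSpace ℝ E]
    [FiniteDimensional ℝ E] [NormedAddCommGroup F] [NormedSpace ℝ F]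
    (G : ι → E → F) (g : E → F) (hG : ∀ i, ContDiff ℝ ∞ (G i)) (hg : ContDiff ℝ ∞ g) :
    (∀ k, CV l k E F G g) ↔ ∀ j : ℕ, ∀ K : Set E, IsCompact K → ∀ ε > 0, ∀ᶠ i in l, ∀ x ∈ K,
      ‖iteratedFDeriv ℝ j (fun y => G i y - g y) x‖ < ε := by
  have : ProperSpace E := FiniteDimensional.proper ℝ E
  constructor
  · intro h j K hK ε hε
    have h1 : ∀ k, CV l k E F (fun i y => G i y - g y) (fun _ => 0) := by
      intro k
      have := CV_sub l k E F G g (fun _ => g) g hG hg (fun _ => hg) hg (h k) (CV_const l k E F g hg)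
      simpa using this
    apply compact_ev hK (P := fun i x => ‖iteratedFDeriv ℝ j (fun y => G i y - g y) x‖ < ε)
    intro y _
    exact (CV_to_iter j E F _ (fun i => (hG i).sub hg) h1 y).eventually (gt_mem_nhds hε)
  · intro h k
    have h1 := iter_to_CV (l := l) k E F (fun i y => G i y - g y) (fun i => (hG i).sub hg) (by
      intro j x0
      rw [Metric.tendsto_nhds]
      intro ε hε
      have := h j (Metric.closedBall x0 1) (isCompact_closedBall _ _) ε hε
      refine eventually_prod_iff.2 ⟨_, this, fun x => x ∈ Metric.closedBall x0 1,
        Metric.closedBall_mem_nhds _ one_pos, ?_⟩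
      intro i hi x hx
      simpa using hi x hx)
    have := CV_add l k E F _ _ (fun _ => g) g (fun i => (hG i).sub hg) contDiff_const
      (fun _ => hg) hg h1 (CV_const l k E F g hg)
    simpa using this

open Filter Topology
open scoped ContDiff

/-! ### Reachable maps -/

lemma hamVF_smooth {d : ℕ} {H : Phase d → ℝ} (hH : ContDiff ℝ ∞ H) : ContDiff ℝ ∞ (hamVF H) := by
  have h1 : ContDiff ℝ ∞ (fderiv ℝ H) := hH.fderiv_right (by simp)
  unfold hamVF
  refine ContDiff.prodMk (contDiff_pi.2 fun i => ?_) (contDiff_pi.2 fun i => ?_)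
  · exact h1.clm_apply contDiff_const
  · exact (h1.clm_apply contDiff_const).neg

lemma isFlowOf_smooth {d : ℕ} {X : Phase d → Phase d} (hX : ContDiff ℝ ∞ X)
    {φ : ℝ → Phase d → Phase d} (hφ : IsFlowOf X φ) (τ : ℝ) : ContDiff ℝ ∞ (φ τ) := by
  refine flow_smooth (fun x => x) contDiff_id (fun x => τ • X x) (contDiff_const (c := τ) |>.smul hX) _ ?_
  intro x
  refine ⟨fun s => φ (s * τ) x, by simp [hφ.1], by simp, fun t _ => ?_⟩
  have h1 : HasDerivAt (fun s : ℝ => s * τ) τ t := by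
    simpa using (hasDerivAt_id t).mul_const τ
  exact ((hφ.2 x (t * τ)).scomp t h1).hasDerivWithinAt

lemma foldl_comp_smooth {d : ℕ} (L : List (Phase d → Phase d)) (hL : ∀ f ∈ L, ContDiff ℝ ∞ f) :
    ∀ g : Phase d → Phase d, ContDiff ℝ ∞ g → ContDiff ℝ ∞ (L.foldl (fun g f => f ∘ g) g) := by
  induction L with
  | nil => intro g hg; simpa using hg
  | cons f L ih =>
    intro g hg
    simp only [List.foldl_cons]
    exact ih (fun f' hf' => hL f' (by simp [hf'])) _ ((hL f (by simp)).comp hg)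

lemma foldl_comp_eq {d : ℕ} (L : List (Phase d → Phase d)) :
    ∀ g : Phase d → Phase d, L.foldl (fun g f => f ∘ g) g = L.foldl (fun g f => f ∘ g) id ∘ g := by
  induction L with
  | nil => intro g; rfl
  | cons f L ih =>
    intro g
    simp only [List.foldl_cons]
    rw [ih (f ∘ g), ih (f ∘ id)]
    rfl

section
variable {d : ℕ} {U : Type} {Ham : U → Phase d → ℝ}

lemma Reachable_smooth (hHam : ∀ u, ContDiff ℝ ∞ (Ham u)) {τ : ℝ} {Φ : Phase d → Phase d}
    (h : Reachable Ham τ Φ) : ContDiff ℝ ∞ Φ := by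
  obtain ⟨n, dur, u, φ, h1, h2, h3, rfl⟩ := h
  refine foldl_comp_smooth _ ?_ _ contDiff_id
  intro f hf
  obtain ⟨i, rfl⟩ := (List.mem_ofFn' _ _).1 hf
  exact isFlowOf_smooth (hamVF_smooth (hHam _)) (h3 i) _

lemma Reachable_comp {τ₁ τ₂ : ℝ} {Φ₁ Φ₂ : Phase d → Phase d}
    (h : Reachable Ham τ₁ Φ₁) (h' : Reachable Ham τ₂ Φ₂) :
    Reachable Ham (τ₁ + τ₂) (fun x => Φ₂ (Φ₁ x)) := by
  obtain ⟨n, dur, u, φ, h1, h2, h3, rfl⟩ := h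
  obtain ⟨n', dur', u', φ', h1', h2', h3', rfl⟩ := h'
  refine ⟨n + n', Fin.append dur dur', Fin.append u u', Fin.append φ φ', ?_, ?_, ?_, ?_⟩
  · intro i
    refine Fin.addCases (fun i => ?_) (fun i => ?_) i
    · simpa using h1 i
    · simpa using h1' i
  · rw [Fin.sum_univ_add]
    simp [h2, h2']
  · intro i
    refine Fin.addCases (fun i => ?_) (fun i => ?_) i
    · simpa using h3 i
    · simpa using h3' i
  · have e : (fun i => Fin.append φ φ' i (Fin.append dur dur' i)) =
        Fin.append (fun i => φ i (dur i)) (fun i => φ' i (dur' i)) := by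
      funext i
      refine Fin.addCases (fun i => ?_) (fun i => ?_) i
      · simp
      · simp
    rw [e, List.ofFn_fin_append, List.foldl_append,
      foldl_comp_eq _ (List.foldl (fun g f => f ∘ g) id (List.ofFn fun i => φ i (dur i)))]
    rfl

lemma STR_of_CV (hHam : ∀ u, ContDiff ℝ ∞ (Ham u)) {ι : Type} {l : Filter ι} [NeBot l]
    (Φ : ι → Phase d → Phase d) (τ : ι → ℝ) (hΦ : ∀ i, Reachable Ham (τ i) (Φ i))
    (hτ0 : ∀ i, 0 ≤ τ i) (hτ : Tendsto τ l (𝓝 0)) (Ψ : Phase d → Phase d) (hΨ : ContDiff ℝ ∞ Ψ)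
    (h : ∀ k, CV l k (Phase d) (Phase d) Φ Ψ) : SmallTimeReachable Ham Ψ := by
  intro ε hε K hK ℓ
  rw [CV_iff_unif Φ Ψ (fun i => Reachable_smooth hHam (hΦ i)) hΨ] at h
  have e1 : ∀ᶠ i in l, ∀ j ∈ Finset.range (ℓ + 1), ∀ x ∈ K,
      ‖iteratedFDeriv ℝ j (fun y => Φ i y - Ψ y) x‖ < ε := by
    rw [eventually_all_finset]
    intro j _
    exact h j K hK ε hε
  have e2 : ∀ᶠ i in l, τ i < ε := hτ.eventually (gt_mem_nhds hε)
  obtain ⟨i, h1, h2⟩ := (e1.and e2).exists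
  refine ⟨τ i, ⟨hτ0 i, h2.le⟩, Φ i, hΦ i, ?_⟩
  intro j hj x hx
  exact h1 j (by simp; omega) x hx

lemma STR_seq (hHam : ∀ u, ContDiff ℝ ∞ (Ham u)) (Ψ : Phase d → Phase d) (hΨ : ContDiff ℝ ∞ Ψ)
    (h : SmallTimeReachable Ham Ψ) :
    ∃ (Φ : ℕ → Phase d → Phase d) (τ : ℕ → ℝ), (∀ i, Reachable Ham (τ i) (Φ i)) ∧
      (∀ i, 0 ≤ τ i) ∧ Tendsto τ atTop (𝓝 0) ∧
      ∀ k, CV atTop k (Phase d) (Phase d) Φ Ψ := by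
  have : ∀ n : ℕ, ∃ (τ : ℝ) (Φ : Phase d → Phase d), 0 ≤ τ ∧ τ ≤ 1 / ((n : ℝ) + 1) ∧
      Reachable Ham τ Φ ∧ CloseCl n (Metric.closedBall 0 n) (1 / ((n : ℝ) + 1)) Φ Ψ := by
    intro n
    obtain ⟨τ, hτ, Φ, h1, h2⟩ := h (1 / ((n : ℝ) + 1)) (by positivity) (Metric.closedBall 0 n)
      (isCompact_closedBall _ _) n
    exact ⟨τ, Φ, hτ.1, hτ.2, h1, h2⟩
  choose τ Φ h0 h1 h2 h3 using this
  refine ⟨Φ, τ, h2, h0, squeeze_zero h0 h1 tendsto_one_div_add_atTop_nhds_zero_nat, ?_⟩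
  rw [CV_iff_unif Φ Ψ (fun i => Reachable_smooth hHam (h2 i)) hΨ]
  intro j K hK ε hε
  obtain ⟨R, hR⟩ := hK.isBounded.subset_closedBall (0 : Phase d)
  have e1 : ∀ᶠ n : ℕ in atTop, 1 / ((n : ℝ) + 1) < ε :=
    tendsto_one_div_add_atTop_nhds_zero_nat.eventually (gt_mem_nhds hε)
  have e2 : ∀ᶠ n : ℕ in atTop, R ≤ n := tendsto_natCast_atTop_atTop.eventually_ge_atTop R
  filter_upwards [e1, e2, eventually_ge_atTop j] with n h4 h5 h6 x hx
  exact (h3 n j h6 x (Metric.closedBall_subset_closedBall h5 (hR hx))).trans h4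

lemma STR_comp (hHam : ∀ u, ContDiff ℝ ∞ (Ham u)) {Ψ₁ Ψ₂ : Phase d → Phase d}
    (h₁ : ContDiff ℝ ∞ Ψ₁) (h₂ : ContDiff ℝ ∞ Ψ₂) (s₁ : SmallTimeReachable Ham Ψ₁)
    (s₂ : SmallTimeReachable Ham Ψ₂) : SmallTimeReachable Ham (fun x => Ψ₂ (Ψ₁ x)) := by
  obtain ⟨Φ₁, τ₁, a1, b1, c1, d1⟩ := STR_seq hHam Ψ₁ h₁ s₁
  obtain ⟨Φ₂, τ₂, a2, b2, c2, d2⟩ := STR_seq hHam Ψ₂ h₂ s₂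
  refine STR_of_CV hHam (l := atTop) (fun n x => Φ₂ n (Φ₁ n x)) (fun n => τ₁ n + τ₂ n)
    (fun n => Reachable_comp (a1 n) (a2 n)) (fun n => add_nonneg (b1 n) (b2 n))
    (by simpa using c1.add c2) _ (h₂.comp h₁) ?_
  intro k
  exact CV_comp _ k _ _ _ Φ₂ Ψ₂ Φ₁ Ψ₁ (fun i => Reachable_smooth hHam (a2 i)) h₂
    (fun i => Reachable_smooth hHam (a1 i)) h₁ (d2 k) (d1 k)

lemma STR_limit (hHam : ∀ u, ContDiff ℝ ∞ (Ham u)) {ι : Type} {l : Filter ι} [NeBot l]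
    (Φ : ι → Phase d → Phase d) (hs : ∀ i, ContDiff ℝ ∞ (Φ i))
    (hΦ : ∀ᶠ i in l, SmallTimeReachable Ham (Φ i))
    (Ψ : Phase d → Phase d) (hΨ : ContDiff ℝ ∞ Ψ)
    (h : ∀ k, CV l k (Phase d) (Phase d) Φ Ψ) : SmallTimeReachable Ham Ψ := by
  intro ε hε K hK ℓ
  rw [CV_iff_unif Φ Ψ hs hΨ] at h
  have e1 : ∀ᶠ i in l, ∀ j ∈ Finset.range (ℓ + 1), ∀ x ∈ K,
      ‖iteratedFDeriv ℝ j (fun y => Φ i y - Ψ y) x‖ < ε / 2 := by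
    rw [eventually_all_finset]
    intro j _
    exact h j K hK (ε / 2) (by positivity)
  obtain ⟨i, h1, h2⟩ := (e1.and hΦ).exists
  obtain ⟨τ, hτ, Θ, r1, r2⟩ := h2 (ε / 2) (by positivity) K hK ℓ
  refine ⟨τ, ⟨hτ.1, hτ.2.trans (by linarith)⟩, Θ, r1, ?_⟩
  intro j hj x hx
  have hΘ := Reachable_smooth hHam r1
  have e : (fun y => Θ y - Ψ y) = fun y => (Θ y - Φ i y) + (Φ i y - Ψ y) := by
    funext y
    abel
  have e2 := iteratedFDeriv_add_apply (i := j) (x := x)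
    (f := fun y => Θ y - Φ i y) (g := fun y => Φ i y - Ψ y)
    ((hΘ.sub (hs i)).of_le (nat_le_inf j)).contDiffAt
    (((hs i).sub hΨ).of_le (nat_le_inf j)).contDiffAt
  rw [e]
  refine lt_of_le_of_lt (le_of_eq_of_le (congrArg norm e2) (norm_add_le _ _)) ?_
  have := r2 j hj x hx
  have := h1 j (by simp; omega) x hx
  linarith

end

open Filter Topology
open scoped ContDiff
open MeasureTheory Real

/-! ### Density of sums of exponentials -/

/-- Linear combinations of exponentials of linear forms. -/
def expSpan (E : Type) [NormedAddCommGroup E] [NormedSpace ℝ E] : Submodule ℝ (E → ℝ) :=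
  Submodule.span ℝ (Set.range fun (L : E →L[ℝ] ℝ) (x : E) => Real.exp (L x))

section
variable {E : Type} [NormedAddCommGroup E] [NormedSpace ℝ E]

lemma expSpan_mul {f g : E → ℝ} (hf : f ∈ expSpan E) (hg : g ∈ expSpan E) : f * g ∈ expSpan E := by
  have h := Submodule.mul_mem_mul hf hg
  unfold expSpan at h
  rw [Submodule.span_mul_span] at h
  refine Submodule.span_mono ?_ h
  rintro _ ⟨_, ⟨L, rfl⟩, _, ⟨M, rfl⟩, rfl⟩
  refine ⟨L + M, ?_⟩
  funext x
  simp [Real.exp_add]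

lemma expSpan_smooth {f : E → ℝ} (hf : f ∈ expSpan E) : ContDiff ℝ ∞ f := by
  refine Submodule.span_induction ?_ ?_ ?_ ?_ hf
  · rintro _ ⟨L, rfl⟩
    exact Real.contDiff_exp.comp L.contDiff
  · exact contDiff_const
  · intro f g _ _ hf hg
    exact hf.add hg
  · intro c f _ hf
    exact contDiff_const.smul hf

lemma expSpan_dense [FiniteDimensional ℝ E] (ρ : E → ℝ) (hρ : Continuous ρ) (R : ℝ) (ε : ℝ)
    (hε : 0 < ε) :
    ∃ P ∈ expSpan E, ∀ x ∈ Metric.closedBall (0 : E) R, ‖P x - ρ x‖ < ε := by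
  have : ProperSpace E := FiniteDimensional.proper ℝ E
  have : CompactSpace (Metric.closedBall (0 : E) R) :=
    isCompact_iff_compactSpace.1 (isCompact_closedBall _ _)
  let e : (E →L[ℝ] ℝ) → C(Metric.closedBall (0 : E) R, ℝ) := fun L =>
    ⟨fun x => Real.exp (L x), by fun_prop⟩
  have hsep : (Algebra.adjoin ℝ (Set.range e)).SeparatesPoints := by
    intro x y hxy
    have hxy' : (x : E) ≠ y := fun h => hxy (Subtype.ext h)
    obtain ⟨L, hL⟩ := SeparatingDual.exists_separating_of_ne (R := ℝ) hxy'
    refine ⟨_, ⟨e L, Algebra.subset_adjoin ⟨L, rfl⟩, rfl⟩, ?_⟩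
    intro h
    exact hL (Real.exp_injective h)
  obtain ⟨g, hg⟩ := ContinuousMap.exists_mem_subalgebra_near_continuous_of_separatesPoints
    _ hsep (fun x => ρ x) (by fun_prop) ε hε
  have hext : ∀ a ∈ Algebra.adjoin ℝ (Set.range e), ∃ P ∈ expSpan E, ∀ x, a x = P x := by
    intro a ha
    refine Algebra.adjoin_induction ?_ ?_ ?_ ?_ ha
    · rintro _ ⟨L, rfl⟩
      exact ⟨_, Submodule.subset_span ⟨L, rfl⟩, fun x => rfl⟩
    · intro r
      refine ⟨r • fun x => Real.exp ((0 : E →L[ℝ] ℝ) x),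
        Submodule.smul_mem _ _ (Submodule.subset_span ⟨0, rfl⟩), fun x => ?_⟩
      simp [Algebra.algebraMap_eq_smul_one]
    · rintro a b _ _ ⟨P, hP, h1⟩ ⟨Q, hQ, h2⟩
      exact ⟨P + Q, Submodule.add_mem _ hP hQ, fun x => by simp [h1, h2]⟩
    · rintro a b _ _ ⟨P, hP, h1⟩ ⟨Q, hQ, h2⟩
      exact ⟨P * Q, expSpan_mul hP hQ, fun x => by simp [h1, h2]⟩
  obtain ⟨P, hP, hPg⟩ := hext g.1 g.2
  refine ⟨P, hP, fun x hx => ?_⟩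
  have := hg ⟨x, hx⟩
  rw [hPg] at this
  exact this

end

section
variable {E : Type} [NormedAddCommGroup E] [NormedSpace ℝ E] [FiniteDimensional ℝ E]
  [MeasurableSpace E] [BorelSpace E] (μ : Measure E) [μ.IsAddHaarMeasure]

/-- Convolution with a scalar kernel. -/
noncomputable def cvl {F : Type} [NormedAddCommGroup F] [NormedSpace ℝ F] (f : E → F) (P : E → ℝ) : E → F :=
  convolution f P (ContinuousLinearMap.lsmul ℝ ℝ : ℝ →L[ℝ] F →L[ℝ] F).flip μ

lemma cvl_apply {F : Type} [NormedAddCommGroup F] [NormedSpace ℝ F] (f : E → F) (P : E → ℝ) (x : E) :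
    cvl μ f P x = ∫ t, P (x - t) • f t ∂μ := by
  simp [cvl, convolution_def]

lemma cvl_fderiv {F : Type} [NormedAddCommGroup F] [NormedSpace ℝ F] (f : E → F) (P : E → ℝ)
    (hf : ContDiff ℝ ∞ f) (hc : HasCompactSupport f) (hP : Continuous P) (x : E) :
    HasFDerivAt (cvl μ f P) (cvl μ (fderiv ℝ f) P x) x := by
  have := hc.hasFDerivAt_convolution_left (μ := μ)
    (ContinuousLinearMap.lsmul ℝ ℝ : ℝ →L[ℝ] F →L[ℝ] F).flip (hf.of_le (by simp))
    (hP.locallyIntegrable) x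
  have e : ContinuousLinearMap.precompL E (ContinuousLinearMap.lsmul ℝ ℝ : ℝ →L[ℝ] F →L[ℝ] F).flip
      = (ContinuousLinearMap.lsmul ℝ ℝ : ℝ →L[ℝ] (E →L[ℝ] F) →L[ℝ] (E →L[ℝ] F)).flip := by
    ext A c
    simp
  rw [e] at this
  exact this

lemma cvl_expSpan (f : E → ℝ) (hf : Continuous f) (hc : HasCompactSupport f) (P : E → ℝ)
    (hP : P ∈ expSpan E) : cvl μ f P ∈ expSpan E := by
  suffices h : Continuous P ∧ cvl μ f P ∈ expSpan E from h.2
  refine Submodule.span_induction ?_ ?_ ?_ ?_ hP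
  · rintro _ ⟨L, rfl⟩
    refine ⟨by fun_prop, ?_⟩
    have : cvl μ f (fun x => Real.exp (L x)) =
        (∫ t, Real.exp (-L t) * f t ∂μ) • fun x => Real.exp (L x) := by
      funext x
      rw [cvl_apply]
      have h1 : ∀ t, Real.exp (L (x - t)) • f t =
          Real.exp (L x) * (Real.exp (-L t) * f t) := by
        intro t
        rw [map_sub, sub_eq_add_neg, Real.exp_add, smul_eq_mul, mul_assoc]
      simp only [h1]
      rw [integral_const_mul, mul_comm]
      rfl
    rw [this]
    exact Submodule.smul_mem _ _ (Submodule.subset_span ⟨L, rfl⟩)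
  · refine ⟨continuous_const, ?_⟩
    have : cvl μ f 0 = 0 := by
      funext x
      simp [cvl_apply]
    rw [this]
    exact Submodule.zero_mem _
  · rintro P Q _ _ ⟨h1, h2⟩ ⟨h3, h4⟩
    refine ⟨h1.add h3, ?_⟩
    have : cvl μ f (P + Q) = cvl μ f P + cvl μ f Q :=
      ConvolutionExists.distrib_add (hc.convolutionExists_left _ hf h1.locallyIntegrable)
        (hc.convolutionExists_left _ hf h3.locallyIntegrable)
    rw [this]
    exact Submodule.add_mem _ h2 h4
  · rintro c P _ ⟨h1, h2⟩
    refine ⟨h1.const_smul c, ?_⟩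
    have : cvl μ f (c • P) = c • cvl μ f P := convolution_smul
    rw [this]
    exact Submodule.smul_mem _ _ h2

lemma kernel_exists : ∃ (P : ℕ → E → ℝ) (φ : ℕ → ContDiffBump (0 : E)),
    (∀ N, P N ∈ expSpan E) ∧ (∀ N, (φ N).rOut = 1 / ((N : ℝ) + 1)) ∧
    ∀ N : ℕ, ∀ x ∈ Metric.closedBall (0 : E) (N : ℝ), ‖P N x - (φ N).normed μ x‖ < 1 / ((N : ℝ) + 1) := by
  let φ : ℕ → ContDiffBump (0 : E) := fun N =>
    ⟨1 / ((N : ℝ) + 1) / 2, 1 / ((N : ℝ) + 1), by positivity, half_lt_self (by positivity)⟩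
  have : ∀ N : ℕ, ∃ P ∈ expSpan E, ∀ x ∈ Metric.closedBall (0 : E) N,
      ‖P x - (φ N).normed μ x‖ < 1 / ((N : ℝ) + 1) := fun N =>
    expSpan_dense _ ((φ N).contDiff_normed (n := 0)).continuous _ _ (by positivity)
  choose P hP h using this
  exact ⟨P, φ, hP, fun N => rfl, h⟩

lemma cvl_conv0 (P : ℕ → E → ℝ) (φ : ℕ → ContDiffBump (0 : E)) (hP : ∀ N, P N ∈ expSpan E)
    (hφ : ∀ N, (φ N).rOut = 1 / ((N : ℝ) + 1))
    (h : ∀ N : ℕ, ∀ x ∈ Metric.closedBall (0 : E) (N : ℝ), ‖P N x - (φ N).normed μ x‖ < 1 / ((N : ℝ) + 1))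
    {F : Type} [NormedAddCommGroup F] [NormedSpace ℝ F] [CompleteSpace F]
    (f : E → F) (hf : Continuous f) (hc : HasCompactSupport f) (R ε : ℝ) (hε : 0 < ε) :
    ∀ᶠ N in atTop, ∀ x ∈ Metric.closedBall (0 : E) R, ‖cvl μ f (P N) x - f x‖ < ε := by
  have : ProperSpace E := FiniteDimensional.proper ℝ E
  have : CompleteSpace E := FiniteDimensional.complete ℝ E
  obtain ⟨R0, hR0⟩ := hc.isCompact.isBounded.subset_closedBall (0 : E)
  set C := ∫ t, ‖f t‖ ∂μ with hC
  have hC0 : 0 ≤ C := integral_nonneg fun t => norm_nonneg _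
  have hint : Integrable f μ := hf.integrable_of_hasCompactSupport hc
  have huc := Metric.uniformContinuous_iff.1 (hc.uniformContinuous_of_continuous hf) (ε / 2)
    (by positivity)
  obtain ⟨δ, hδ, hδ'⟩ := huc
  have t1 : Tendsto (fun N : ℕ => 1 / ((N : ℝ) + 1)) atTop (𝓝 0) :=
    tendsto_one_div_add_atTop_nhds_zero_nat
  have ev1 : ∀ᶠ N : ℕ in atTop, 1 / ((N : ℝ) + 1) < δ := t1.eventually (gt_mem_nhds hδ)
  have ev2 : ∀ᶠ N : ℕ in atTop, 1 / ((N : ℝ) + 1) * C < ε / 2 := by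
    have := t1.mul_const C
    rw [zero_mul] at this
    exact this.eventually (gt_mem_nhds (by positivity))
  have ev3 : ∀ᶠ N : ℕ in atTop, R + R0 ≤ N := tendsto_natCast_atTop_atTop.eventually_ge_atTop _
  filter_upwards [ev1, ev2, ev3] with N h1 h2 h3 x hx
  have b1 : ‖cvl μ f ((φ N).normed μ) x - f x‖ ≤ ε / 2 := by
    have e : cvl μ f ((φ N).normed μ) = convolution ((φ N).normed μ) f
        (ContinuousLinearMap.lsmul ℝ ℝ) μ := convolution_flip _
    rw [e, ← dist_eq_norm]
    refine ContDiffBump.dist_normed_convolution_le hf.aestronglyMeasurable ?_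
    intro y hy
    rw [hφ] at hy
    exact (hδ' ((Metric.mem_ball.1 hy).trans h1)).le
  have hPc : Continuous (P N) := (expSpan_smooth (hP N)).continuous
  have hφc : Continuous ((φ N).normed μ) := ((φ N).contDiff_normed (n := 0)).continuous
  have i1 : Integrable (fun t => P N (x - t) • f t) μ :=
    (Continuous.integrable_of_hasCompactSupport (by fun_prop) hc.smul_left)
  have i2 : Integrable (fun t => (φ N).normed μ (x - t) • f t) μ :=
    (Continuous.integrable_of_hasCompactSupport
      ((hφc.comp (continuous_const.sub continuous_id)).smul hf) hc.smul_left)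
  have b2 : ‖cvl μ f (P N) x - cvl μ f ((φ N).normed μ) x‖ ≤ 1 / ((N : ℝ) + 1) * C := by
    rw [cvl_apply, cvl_apply, ← integral_sub i1 i2, hC, ← integral_const_mul]
    refine norm_integral_le_of_norm_le (hint.norm.const_mul _) (Eventually.of_forall fun t => ?_)
    rw [← sub_smul, norm_smul]
    by_cases ht : f t = 0
    · simp [ht]
    · have ht' : t ∈ Metric.closedBall (0 : E) R0 := hR0 (subset_closure ht)
      gcongr
      refine (h N (x - t) ?_).le
      rw [mem_closedBall_zero_iff] at *
      exact (norm_sub_le _ _).trans (by linarith)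
  calc ‖cvl μ f (P N) x - f x‖ ≤ ‖cvl μ f (P N) x - cvl μ f ((φ N).normed μ) x‖
        + ‖cvl μ f ((φ N).normed μ) x - f x‖ := norm_sub_le_norm_sub_add_norm_sub _ _ _
    _ < ε := by linarith

lemma cvl_conv (P : ℕ → E → ℝ) (φ : ℕ → ContDiffBump (0 : E)) (hP : ∀ N, P N ∈ expSpan E)
    (hφ : ∀ N, (φ N).rOut = 1 / ((N : ℝ) + 1))
    (h : ∀ N : ℕ, ∀ x ∈ Metric.closedBall (0 : E) (N : ℝ), ‖P N x - (φ N).normed μ x‖ < 1 / ((N : ℝ) + 1))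
    (R ε : ℝ) (hε : 0 < ε) (j : ℕ) :
    ∀ {F : Type} [NormedAddCommGroup F] [NormedSpace ℝ F] [CompleteSpace F]
    (f : E → F) (_ : ContDiff ℝ ∞ f) (_ : HasCompactSupport f),
    ∀ᶠ N in atTop, ∀ x ∈ Metric.closedBall (0 : E) R,
      ‖iteratedFDeriv ℝ j (fun y => cvl μ f (P N) y - f y) x‖ < ε := by
  induction j with
  | zero =>
    intro F _ _ _ f hf hc
    simp only [norm_iteratedFDeriv_zero]
    exact cvl_conv0 μ P φ hP hφ h f hf.continuous hc R ε hε
  | succ j ih =>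
    intro F _ _ _ f hf hc
    have := ih (fderiv ℝ f) (hf.fderiv_right (by simp)) (hc.fderiv ℝ)
    filter_upwards [this] with N hN x hx
    rw [← norm_iteratedFDeriv_fderiv]
    have e : fderiv ℝ (fun y => cvl μ f (P N) y - f y) =
        fun y => cvl μ (fderiv ℝ f) (P N) y - fderiv ℝ f y := by
      funext y
      exact ((cvl_fderiv μ f (P N) hf hc (expSpan_smooth (hP N)).continuous y).sub
        (smooth_diff hf y).hasFDerivAt).fderiv
    rw [e]
    exact hN x hx

end

/-- Sums of exponentials are dense among smooth functions. -/
lemma expSpan_approx {E : Type} [NormedAddCommGroup E] [NormedSpace ℝ E] [FiniteDimensional ℝ E]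
    (H : E → ℝ) (hH : ContDiff ℝ ∞ H) :
    ∃ Q : ℕ → E → ℝ, (∀ N, Q N ∈ expSpan E) ∧ ∀ k, CV atTop k E ℝ Q H := by
  letI : MeasurableSpace E := borel E
  haveI : BorelSpace E := ⟨rfl⟩
  let μ : Measure E := Measure.addHaar
  obtain ⟨P, φ, hP, hφ, h⟩ := kernel_exists (E := E) μ
  have key : ∀ N : ℕ, ∃ Q ∈ expSpan E, ∀ j ≤ N, ∀ x ∈ Metric.closedBall (0 : E) N,
      ‖iteratedFDeriv ℝ j (fun y => Q y - H y) x‖ < 1 / ((N : ℝ) + 1) := by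
    intro N
    let χ : ContDiffBump (0 : E) := ⟨(N : ℝ) + 1, N + 2, by positivity, by linarith⟩
    have hfs : ContDiff ℝ ∞ (fun x => χ x * H x) := χ.contDiff.mul hH
    have hfc : HasCompactSupport (fun x => χ x * H x) := χ.hasCompactSupport.mul_right
    have ev : ∀ᶠ M in atTop, ∀ j ∈ Finset.range (N + 1), ∀ x ∈ Metric.closedBall (0 : E) N,
        ‖iteratedFDeriv ℝ j (fun y => cvl μ (fun x => χ x * H x) (P M) y - χ y * H y) x‖
          < 1 / ((N : ℝ) + 1) := by
      rw [eventually_all_finset]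
      intro j _
      exact cvl_conv μ P φ hP hφ h N _ (by positivity) j _ hfs hfc
    obtain ⟨M, hM⟩ := ev.exists
    refine ⟨_, cvl_expSpan μ _ hfs.continuous hfc _ (hP M), ?_⟩
    intro j hj x hx
    have h1 := hM j (by simp; omega) x hx
    have e : (fun y => cvl μ (fun x => χ x * H x) (P M) y - χ y * H y) =ᶠ[𝓝 x]
        (fun y => cvl μ (fun x => χ x * H x) (P M) y - H y) := by
      have : Metric.ball (0 : E) (N + 1) ∈ 𝓝 x := by
        refine Metric.isOpen_ball.mem_nhds ?_
        rw [mem_closedBall_zero_iff] at hx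
        rw [mem_ball_zero_iff]
        linarith
      filter_upwards [this] with y hy
      have : χ y = 1 := χ.one_of_mem_closedBall (Metric.ball_subset_closedBall hy)
      rw [this, one_mul]
    rw [(e.iteratedFDeriv ℝ j).eq_of_nhds] at h1
    exact h1
  choose Q hQ hQ2 using key
  refine ⟨Q, hQ, ?_⟩
  rw [CV_iff_unif Q H (fun N => expSpan_smooth (hQ N)) hH]
  intro j K hK ε hε
  obtain ⟨R, hR⟩ := hK.isBounded.subset_closedBall (0 : E)
  have e1 : ∀ᶠ n : ℕ in atTop, 1 / ((n : ℝ) + 1) < ε :=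
    tendsto_one_div_add_atTop_nhds_zero_nat.eventually (gt_mem_nhds hε)
  have e2 : ∀ᶠ n : ℕ in atTop, R ≤ n := tendsto_natCast_atTop_atTop.eventually_ge_atTop R
  filter_upwards [e1, e2, eventually_ge_atTop j] with n h4 h5 h6 x hx
  exact (hQ2 n j h6 x (Metric.closedBall_subset_closedBall h5 (hR hx))).trans h4

open Filter Topology
open scoped ContDiff

/-! ### Ridge maps and assembly -/

lemma clm_sum {d : ℕ} (α : (Fin d → ℝ) →L[ℝ] ℝ) (v : Fin d → ℝ) :
    α v = ∑ i, v i * α (Pi.single i 1) := by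
  conv_lhs => rw [pi_eq_sum_univ' v]
  rw [map_sum]
  refine Finset.sum_congr rfl fun i _ => ?_
  rw [map_smul, smul_eq_mul]

lemma vshear_smooth {d : ℕ} {f : (Fin d → ℝ) → ℝ} (hf : ContDiff ℝ ∞ f) :
    ContDiff ℝ ∞ (vshear f) := by
  have h1 : ContDiff ℝ ∞ (fderiv ℝ f) := hf.fderiv_right (by simp)
  unfold vshear
  refine ContDiff.prodMk contDiff_fst (contDiff_pi.2 fun i => ?_)
  exact ContDiff.sub (by fun_prop) ((h1.comp contDiff_fst).clm_apply contDiff_const)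

lemma hshear_smooth {d : ℕ} {f : (Fin d → ℝ) → ℝ} (hf : ContDiff ℝ ∞ f) :
    ContDiff ℝ ∞ (hshear f) := by
  have h1 : ContDiff ℝ ∞ (fderiv ℝ f) := hf.fderiv_right (by simp)
  unfold hshear
  refine ContDiff.prodMk (contDiff_pi.2 fun i => ?_) contDiff_snd
  exact ContDiff.add (by fun_prop) ((h1.comp contDiff_snd).clm_apply contDiff_const)

lemma fderiv_exp_clm {d : ℕ} (s : ℝ) (α : (Fin d → ℝ) →L[ℝ] ℝ) (x v : Fin d → ℝ) :
    fderiv ℝ (fun y => s * Real.exp (α y)) x v = s * Real.exp (α x) * α v := by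
  have h : HasFDerivAt (fun y => s * Real.exp (α y)) (s • (Real.exp (α x) • α)) x :=
    (α.hasFDerivAt.exp).const_mul s
  rw [h.fderiv]
  simp [mul_assoc]

lemma fderiv_quad {d : ℕ} (c e : ℝ) (α β : (Fin d → ℝ) →L[ℝ] ℝ) (x v : Fin d → ℝ) :
    fderiv ℝ (fun y => c * (α y * β y) + e * (α y * α y)) x v =
      c * (α x * β v + β x * α v) + e * (α x * α v + α x * α v) := by
  have h : HasFDerivAt (fun y => c * (α y * β y) + e * (α y * α y))
      (c • (α x • β + β x • α) + e • (α x • α + α x • α)) x :=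
    ((α.hasFDerivAt.mul β.hasFDerivAt).const_mul c).add
      ((α.hasFDerivAt.mul α.hasFDerivAt).const_mul e)
  rw [h.fderiv]
  simp
  ring

/-- The Euler step of the Hamiltonian field of `s * exp (α q + β p)`. -/
noncomputable def ridge {d : ℕ} (α β : (Fin d → ℝ) →L[ℝ] ℝ) (s : ℝ) : Phase d → Phase d := fun x =>
  (fun i => x.1 i + s * Real.exp (α x.1 + β x.2) * β (Pi.single i 1),
   fun i => x.2 i - s * Real.exp (α x.1 + β x.2) * α (Pi.single i 1))

section
variable {d : ℕ} {U : Type} {Ham : U → Phase d → ℝ}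

lemma ridge_STR (hHam : ∀ u, ContDiff ℝ ∞ (Ham u))
    (hvert : ∀ f : (Fin d → ℝ) → ℝ, ContDiff ℝ ∞ f → SmallTimeReachable Ham (vshear f))
    (hhor : ∀ f : (Fin d → ℝ) → ℝ, ContDiff ℝ ∞ f → SmallTimeReachable Ham (hshear f))
    (α β : (Fin d → ℝ) →L[ℝ] ℝ) (s : ℝ) : SmallTimeReachable Ham (ridge α β s) := by
  have hexp : ∀ γ : (Fin d → ℝ) →L[ℝ] ℝ, ContDiff ℝ ∞ (fun y => s * Real.exp (γ y)) := by
    intro γ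
    fun_prop
  by_cases hα : α = 0
  · subst hα
    have e : ridge 0 β s = hshear (fun y => s * Real.exp (β y)) := by
      funext x
      simp [ridge, hshear, fderiv_exp_clm]
    rw [e]
    exact hhor _ (hexp β)
  · set a : Fin d → ℝ := fun i => α (Pi.single i 1) with ha
    have hαa : α a = ∑ i, a i ^ 2 := by
      rw [clm_sum α a]
      exact Finset.sum_congr rfl fun i _ => by rw [sq]
    have hn : α a ≠ 0 := by
      rw [hαa]
      intro h0
      apply hα
      rw [Finset.sum_eq_zero_iff_of_nonneg (fun i _ => sq_nonneg _)] at h0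
      ext v
      rw [clm_sum α v]
      refine Finset.sum_eq_zero fun i hi => ?_
      have := h0 i hi
      have h2 : a i = 0 := by simpa using this
      change v i * a i = 0
      rw [h2, mul_zero]
    set n := α a with hndef
    set b : Fin d → ℝ := fun i => β (Pi.single i 1) with hb
    have hαb : α b = β a := by
      rw [clm_sum α b, clm_sum β a]
      exact Finset.sum_congr rfl fun i _ => mul_comm _ _
    let g : ℝ → (Fin d → ℝ) → ℝ := fun r y => (r / n) * (α y * β y)
      + (-(r * β a / (2 * n ^ 2))) * (α y * α y)
    have hg : ∀ r, ContDiff ℝ ∞ (g r) := by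
      intro r
      fun_prop
    -- the symmetric matrix as a linear combination
    have hgrad : ∀ r p i, fderiv ℝ (g r) p (Pi.single i 1) =
        r * ((β p / n - β a * α p / n ^ 2) * a i + (α p / n) * b i) := by
      intro r p i
      change fderiv ℝ (fun y => (r / n) * (α y * β y)
        + (-(r * β a / (2 * n ^ 2))) * (α y * α y)) p (Pi.single i 1) = _
      rw [fderiv_quad]
      change r / n * (α p * b i + β p * a i) + -(r * β a / (2 * n ^ 2)) * (α p * a i + α p * a i) = _
      field_simp
      ring
    have e : ridge α β s = fun x => hshear (g (-1)) (vshear (fun y => s * Real.exp (α y))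
        (hshear (g 1) x)) := by
      funext x
      obtain ⟨q, p⟩ := x
      have h1 : (fun i => q i + fderiv ℝ (g 1) p (Pi.single i 1)) =
          q + ((β p / n - β a * α p / n ^ 2) • a + (α p / n) • b) := by
        funext i
        rw [hgrad]
        simp
      have h2 : α (q + ((β p / n - β a * α p / n ^ 2) • a + (α p / n) • b)) = α q + β p := by
        simp only [map_add, map_smul, smul_eq_mul, hαb, ← hndef]
        field_simp
        ring
      set w := s * Real.exp (α q + β p) with hw
      have h3 : (fun i => p i - fderiv ℝ (fun y => s * Real.exp (α y))
          (q + ((β p / n - β a * α p / n ^ 2) • a + (α p / n) • b)) (Pi.single i 1)) = p - w • a := by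
        funext i
        rw [fderiv_exp_clm, h2]
        simp [hw, ha]
      simp only [hshear, vshear]
      rw [h1, h3]
      simp only [hgrad]
      refine Prod.ext ?_ ?_
      · funext i
        simp only [ridge, map_sub, map_smul, smul_eq_mul, Pi.add_apply, Pi.smul_apply, ← hndef]
        change q i + w * b i = _
        field_simp
        ring
      · funext i
        simp [ridge, ← hw, ha]
    rw [e]
    exact STR_comp hHam ((vshear_smooth (hexp α)).comp (hshear_smooth (hg 1))) (hshear_smooth (hg (-1)))
      (STR_comp hHam (hshear_smooth (hg 1)) (vshear_smooth (hexp α)) (hhor _ (hg 1))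
        (hvert _ (hexp α))) (hhor _ (hg (-1)))

lemma ridge_smooth (α β : (Fin d → ℝ) →L[ℝ] ℝ) (s : ℝ) : ContDiff ℝ ∞ (ridge α β s) := by
  unfold ridge
  fun_prop

/-- Maps of extended phase space which shift time and are fiberwise reachable. -/
def Good (Ham : U → Phase d → ℝ) (A : ℝ × Phase d → ℝ × Phase d) : Prop :=
  ∃ (s : ℝ) (Ψ : ℝ → Phase d → Phase d), (∀ t, ContDiff ℝ ∞ (Ψ t)) ∧
    (∀ t, SmallTimeReachable Ham (Ψ t)) ∧ ∀ z, A z = (z.1 + s, Ψ z.1 z.2)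

lemma Good_comp (hHam : ∀ u, ContDiff ℝ ∞ (Ham u)) {A B : ℝ × Phase d → ℝ × Phase d}
    (hA : Good Ham A) (hB : Good Ham B) : Good Ham (fun z => B (A z)) := by
  obtain ⟨s, Ψ, h1, h2, h3⟩ := hA
  obtain ⟨s', Ψ', h1', h2', h3'⟩ := hB
  refine ⟨s + s', fun t x => Ψ' (t + s) (Ψ t x), fun t => (h1' _).comp (h1 _),
    fun t => STR_comp hHam (h1 _) (h1' _) (h2 _) (h2' _), fun z => ?_⟩
  simp only [h3', h3, add_assoc]

lemma STR_id : SmallTimeReachable Ham (fun x => x) := by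
  intro ε hε K _ ℓ
  refine ⟨0, ⟨le_rfl, hε.le⟩, fun x => x, ⟨0, Fin.elim0, Fin.elim0, Fin.elim0, fun i => i.elim0,
    by simp, fun i => i.elim0, rfl⟩, ?_⟩
  intro j _ x _
  have : (fun y : Phase d => y - y) = fun _ => 0 := by
    funext y
    simp
  rw [this]
  simpa [iteratedFDeriv_fun_zero] using hε

lemma Good_id : Good Ham (fun z => z) :=
  ⟨0, fun _ x => x, fun _ => contDiff_id, fun _ => STR_id, fun z => by simp⟩

lemma Good_iter (hHam : ∀ u, ContDiff ℝ ∞ (Ham u)) {A : ℝ × Phase d → ℝ × Phase d}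
    (hA : Good Ham A) (n : ℕ) : Good Ham (fun z => A^[n] z) := by
  induction n with
  | zero => exact Good_id
  | succ n ih =>
    have h := Good_comp hHam hA ih
    simpa only [Function.iterate_succ_apply] using h

/-- The extended symplectic gradient. -/
noncomputable def Jext (d : ℕ) : ((ℝ × Phase d) →L[ℝ] ℝ) →L[ℝ] (ℝ × Phase d) :=
  LinearMap.toContinuousLinearMap
    { toFun := fun μ => (0, (fun i => μ (0, (0, Pi.single i 1)), fun i => -μ (0, (Pi.single i 1, 0))))
      map_add' := by
        intro μ ν
        ext <;> simp <;> ring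
      map_smul' := by
        intro c μ
        ext <;> simp }

lemma Jext_apply (μ : (ℝ × Phase d) →L[ℝ] ℝ) : Jext d μ =
    (0, (fun i => μ (0, (0, Pi.single i 1)), fun i => -μ (0, (Pi.single i 1, 0)))) := rfl

/-- A field approximable by reachable Euler steps. -/
def Claim (Ham : U → Phase d → ℝ) (X : ℝ × Phase d → ℝ × Phase d) : Prop :=
  ContDiff ℝ ∞ X ∧ ∃ a : ℕ → ℝ × Phase d → ℝ × Phase d, (∀ n, ContDiff ℝ ∞ (a n)) ∧
    (∀ n : ℕ, Good Ham (fun z => z + (1 / n : ℝ) • a n z)) ∧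
    ∀ k, CV atTop k (ℝ × Phase d) (ℝ × Phase d) a X

lemma Claim_add (hHam : ∀ u, ContDiff ℝ ∞ (Ham u)) {X Y : ℝ × Phase d → ℝ × Phase d}
    (hX : Claim Ham X) (hY : Claim Ham Y) : Claim Ham (fun z => X z + Y z) := by
  obtain ⟨sX, a, a1, a2, a3⟩ := hX
  obtain ⟨sY, b, b1, b2, b3⟩ := hY
  have st : ∀ n : ℕ, ContDiff ℝ ∞ (fun z => z + (1 / n : ℝ) • a n z) := fun n =>
    contDiff_id.add (ContDiff.smul (f := fun _ => (1 / n : ℝ)) contDiff_const (a1 n))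
  refine ⟨sX.add sY, fun n z => a n z + b n (z + (1 / n : ℝ) • a n z), fun n =>
    (a1 n).add ((b1 n).comp (st n)), fun n => ?_, fun k => ?_⟩
  · have h := Good_comp hHam (a2 n) (b2 n)
    simpa only [smul_add, add_assoc] using h
  · have h1 : CV atTop k (ℝ × Phase d) (ℝ × Phase d) (fun (n : ℕ) z => z + (1 / n : ℝ) • a n z)
        (fun z => z + (0 : ℝ) • X z) :=
      CV_add _ k _ _ (fun _ z => z) (fun z => z) _ _ (fun _ => contDiff_id) contDiff_id
        (fun n => ContDiff.smul (f := fun _ => (1 / n : ℝ)) contDiff_const (a1 n))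
        (ContDiff.smul (f := fun _ => (0 : ℝ)) contDiff_const sX)
        (CV_const _ k _ _ _ contDiff_id)
        (CV_smul _ k _ 0 tendsto_one_div_atTop_nhds_zero_nat _ _ a X a1 sX (a3 k))
    have e : (fun z => z + (0 : ℝ) • X z) = fun z => z := by
      funext z
      simp
    rw [e] at h1
    have h2 := CV_comp _ k _ _ _ b Y _ _ b1 sY st contDiff_id (b3 k) h1
    exact CV_add _ k _ _ a X _ _ a1 sX (fun n => (b1 n).comp (st n)) sY (a3 k) h2

lemma Claim_time : Claim Ham (fun _ => ((1 : ℝ), (0 : Phase d))) := by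
  refine ⟨contDiff_const, fun _ _ => (1, 0), fun _ => contDiff_const, fun n => ?_,
    fun k => CV_const _ k _ _ _ contDiff_const⟩
  exact ⟨1 / n, fun _ x => x, fun _ => contDiff_id, fun _ => STR_id, fun z => by
    ext <;> simp⟩

lemma Jfderiv_smooth {Q : ℝ × Phase d → ℝ} (hQ : ContDiff ℝ ∞ Q) :
    ContDiff ℝ ∞ (fun z => Jext d (fderiv ℝ Q z)) :=
  (Jext d).contDiff.comp (hQ.fderiv_right (by simp))

lemma Claim_exp (hHam : ∀ u, ContDiff ℝ ∞ (Ham u))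
    (hvert : ∀ f : (Fin d → ℝ) → ℝ, ContDiff ℝ ∞ f → SmallTimeReachable Ham (vshear f))
    (hhor : ∀ f : (Fin d → ℝ) → ℝ, ContDiff ℝ ∞ f → SmallTimeReachable Ham (hshear f))
    (c : ℝ) (L : (ℝ × Phase d) →L[ℝ] ℝ) :
    Claim Ham (fun z => Jext d (fderiv ℝ (c • fun x => Real.exp (L x)) z)) := by
  have hs : ContDiff ℝ ∞ (c • fun x => Real.exp (L x)) :=
    contDiff_const.smul (Real.contDiff_exp.comp L.contDiff)
  refine ⟨Jfderiv_smooth hs, fun _ z => Jext d (fderiv ℝ (c • fun x => Real.exp (L x)) z),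
    fun _ => Jfderiv_smooth hs, fun n => ?_, fun k => CV_const _ k _ _ _ (Jfderiv_smooth hs)⟩
  have hf : ∀ z, fderiv ℝ (c • fun x => Real.exp (L x)) z = c • (Real.exp (L z) • L) := by
    intro z
    exact ((L.hasFDerivAt.exp).const_smul c).fderiv
  let α : (Fin d → ℝ) →L[ℝ] ℝ := L.comp ((ContinuousLinearMap.inr ℝ ℝ (Phase d)).comp
    (ContinuousLinearMap.inl ℝ (Fin d → ℝ) (Fin d → ℝ)))
  let β : (Fin d → ℝ) →L[ℝ] ℝ := L.comp ((ContinuousLinearMap.inr ℝ ℝ (Phase d)).comp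
    (ContinuousLinearMap.inr ℝ (Fin d → ℝ) (Fin d → ℝ)))
  have hα : ∀ q, α q = L (0, (q, 0)) := fun q => rfl
  have hβ : ∀ q, β q = L (0, (0, q)) := fun q => rfl
  refine ⟨0, fun t => ridge α β ((1 / n) * c * Real.exp (L (t, 0))), fun t => ridge_smooth _ _ _,
    fun t => ridge_STR hHam hvert hhor _ _ _, fun z => ?_⟩
  obtain ⟨t, q, p⟩ := z
  have hL : L (t, (q, p)) = L (t, 0) + (α q + β p) := by
    rw [hα, hβ, ← map_add, ← map_add]
    congr 1
    simp
  simp only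
  rw [hf, hL, Real.exp_add, Jext_apply]
  refine Prod.ext (by simp) (Prod.ext ?_ ?_)
  · funext i
    simp [ridge, hβ]
    ring
  · funext i
    simp [ridge, hα]
    ring

lemma Claim_span (hHam : ∀ u, ContDiff ℝ ∞ (Ham u))
    (hvert : ∀ f : (Fin d → ℝ) → ℝ, ContDiff ℝ ∞ f → SmallTimeReachable Ham (vshear f))
    (hhor : ∀ f : (Fin d → ℝ) → ℝ, ContDiff ℝ ∞ f → SmallTimeReachable Ham (hshear f))
    (Q : ℝ × Phase d → ℝ) (hQ : Q ∈ expSpan (ℝ × Phase d)) :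
    Claim Ham (fun z => Jext d (fderiv ℝ Q z)) := by
  suffices h : ∀ c : ℝ, Claim Ham (fun z => Jext d (fderiv ℝ (c • Q) z)) by
    simpa using h 1
  refine Submodule.span_induction (p := fun Q _ => ∀ c : ℝ,
    Claim Ham (fun z => Jext d (fderiv ℝ (c • Q) z))) ?_ ?_ ?_ ?_ hQ
  · rintro _ ⟨L, rfl⟩ c
    exact Claim_exp hHam hvert hhor c L
  · intro c
    have := Claim_exp hHam hvert hhor 0 (0 : (ℝ × Phase d) →L[ℝ] ℝ)
    simpa using this
  · intro P Q hP hQ h1 h2 c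
    have sP : ContDiff ℝ ∞ (c • P) := contDiff_const.smul (expSpan_smooth hP)
    have sQ : ContDiff ℝ ∞ (c • Q) := contDiff_const.smul (expSpan_smooth hQ)
    have h := Claim_add hHam (h1 c) (h2 c)
    have e : (fun z => Jext d (fderiv ℝ (c • (P + Q)) z)) = fun z =>
        Jext d (fderiv ℝ (c • P) z) + Jext d (fderiv ℝ (c • Q) z) := by
      funext z
      rw [smul_add, fderiv_add (smooth_diff sP z) (smooth_diff sQ z), map_add]
    rw [e]
    exact h
  · intro c P _ h c'
    rw [smul_smul]
    exact h _

lemma CV_Jfderiv {l : Filter ℕ} (Q : ℕ → ℝ × Phase d → ℝ) (H : ℝ × Phase d → ℝ)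
    (hQ : ∀ N, ContDiff ℝ ∞ (Q N)) (hH : ContDiff ℝ ∞ H)
    (h : ∀ k, CV l k (ℝ × Phase d) ℝ Q H) (k : ℕ) :
    CV l k (ℝ × Phase d) (ℝ × Phase d) (fun N z => Jext d (fderiv ℝ (Q N) z))
      (fun z => Jext d (fderiv ℝ H z)) := by
  revert k
  rw [CV_iff_unif _ _ (fun N => Jfderiv_smooth (hQ N)) (Jfderiv_smooth hH)]
  rw [CV_iff_unif Q H hQ hH] at h
  intro j K hK ε hε
  have := h (j + 1) K hK (ε / (‖Jext d‖ + 1)) (by positivity)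
  filter_upwards [this] with N hN x hx
  have hd : ContDiff ℝ ∞ (fun y => Q N y - H y) := (hQ N).sub hH
  have e : (fun y => Jext d (fderiv ℝ (Q N) y) - Jext d (fderiv ℝ H y)) =
      fun y => Jext d (fderiv ℝ (fun y => Q N y - H y) y) := by
    funext y
    rw [fderiv_fun_sub (smooth_diff (hQ N) y) (smooth_diff hH y), map_sub]
  rw [e]
  refine (iter_comp_left_le (hd.fderiv_right (by simp)) (Jext d) j x).trans_lt ?_
  rw [norm_iteratedFDeriv_fderiv]
  have h2 := hN x hx
  rw [lt_div_iff₀ (by positivity)] at h2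
  nlinarith [norm_nonneg (iteratedFDeriv ℝ (j + 1) (fun y => Q N y - H y) x)]

lemma main_assembly (hHam : ∀ u, ContDiff ℝ ∞ (Ham u))
    (hvert : ∀ f : (Fin d → ℝ) → ℝ, ContDiff ℝ ∞ f → SmallTimeReachable Ham (vshear f))
    (hhor : ∀ f : (Fin d → ℝ) → ℝ, ContDiff ℝ ∞ f → SmallTimeReachable Ham (hshear f))
    (Φ : Phase d → Phase d) (hΦ : IsHamDiffeo Φ) : SmallTimeReachable Ham Φ := by
  obtain ⟨⟨sΦ, -⟩, H, φ, hH, h0, hflow, hΦ⟩ := hΦ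
  set Hh : ℝ × Phase d → ℝ := fun z => H z.1 z.2 with hHh
  obtain ⟨Q, hQ, hQH⟩ := expSpan_approx Hh hH
  have key : ∀ N, Claim Ham (fun z => ((1 : ℝ), (0 : Phase d)) + Jext d (fderiv ℝ (Q N) z)) :=
    fun N => Claim_add hHam Claim_time (Claim_span hHam hvert hhor (Q N) (hQ N))
  choose sX a sa ga ca using key
  have sY : ContDiff ℝ ∞ (fun z => ((1 : ℝ), (0 : Phase d)) + Jext d (fderiv ℝ Hh z)) :=
    contDiff_const.add (Jfderiv_smooth hH)
  have cX : ∀ k, CV atTop k (ℝ × Phase d) (ℝ × Phase d)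
      (fun N z => ((1 : ℝ), (0 : Phase d)) + Jext d (fderiv ℝ (Q N) z))
      (fun z => ((1 : ℝ), (0 : Phase d)) + Jext d (fderiv ℝ Hh z)) := fun k =>
    CV_add _ k _ _ _ _ _ _ (fun _ => contDiff_const) contDiff_const
      (fun N => Jfderiv_smooth (expSpan_smooth (hQ N))) (Jfderiv_smooth hH)
      (CV_const _ k _ _ _ contDiff_const)
      (CV_Jfderiv Q Hh (fun N => expSpan_smooth (hQ N)) hH hQH k)
  have cA := fun k => CV_curry k _ _ a _ _ sX sY (fun N => ca N k) (cX k)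
  have hn : Tendsto (fun p : ℕ × ℕ => p.2) ((atTop : Filter ℕ).curry atTop) atTop :=
    tendsto_snd.mono_left curry_le_prod
  haveI hne : NeBot ((atTop : Filter ℕ).curry (atTop : Filter ℕ)) := by
    rw [neBot_iff, Ne, ← eventually_false_iff_eq_bot, eventually_curry_iff]
    simp only [eventually_const, not_false_eq_true]
  have hsol : ∀ x, Sol (fun z => ((1 : ℝ), (0 : Phase d)) + Jext d (fderiv ℝ Hh z))
      ((0 : ℝ), x) ((1 : ℝ), Φ x) := by
    intro x
    refine ⟨fun t => (t, φ t x), by simp [h0], by simp [hΦ], fun t ht => ?_⟩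
    have e : ((1 : ℝ), (0 : Phase d)) + Jext d (fderiv ℝ Hh (t, φ t x)) =
        (1, hamVF (H t) (φ t x)) := by
      have hfd : ∀ v, fderiv ℝ (H t) (φ t x) v = fderiv ℝ Hh (t, φ t x) (0, v) := by
        intro v
        have h1 : HasFDerivAt (fun y : Phase d => (t, y))
            (ContinuousLinearMap.inr ℝ ℝ (Phase d)) (φ t x) := hasFDerivAt_prodMk_right _ _
        have h2 : HasFDerivAt (H t) _ (φ t x) :=
          HasFDerivAt.comp (g := Hh) (φ t x) (smooth_diff hH (t, φ t x)).hasFDerivAt h1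
        rw [h2.fderiv]
        rfl
      rw [Jext_apply]
      simp [hamVF, hfd]
    simp only
    rw [e]
    exact (hasDerivWithinAt_id t _).prodMk (hflow x t ht)
  have sj : ContDiff ℝ ∞ (fun x : Phase d => ((0 : ℝ), x)) := by fun_prop
  have cF := fun k => flow_CV (l := (atTop : Filter ℕ).curry (atTop : Filter ℕ))
    (fun p : ℕ × ℕ => p.2) hn k _ _ (fun x : Phase d => ((0 : ℝ), x)) sj _ sY _ hsol
    (fun p => a p.1 p.2) (fun p => sa p.1 p.2) cA
  have sit : ∀ p : ℕ × ℕ, ContDiff ℝ ∞ (fun x : Phase d =>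
      (fun y => y + (1 / p.2 : ℝ) • a p.1 p.2 y)^[p.2] ((0 : ℝ), x)) := fun p =>
    (Tan_iter _ sj (a p.1 p.2) (sa p.1 p.2) _ p.2).1
  have cS := fun k => CV_comp _ k _ _ _ (fun _ : ℕ × ℕ => (Prod.snd : ℝ × Phase d → Phase d)) Prod.snd
    _ _ (fun _ => contDiff_snd) contDiff_snd sit (contDiff_const.prodMk sΦ)
    (CV_const _ k _ _ _ contDiff_snd) (cF k)
  refine STR_limit hHam _ (fun p => contDiff_snd.comp (sit p)) (Eventually.of_forall fun p => ?_)
    Φ sΦ cS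
  obtain ⟨s, Ψ, h1, h2, h3⟩ := Good_iter hHam (ga p.1 p.2) p.2
  have e : (Prod.snd ∘ fun x : Phase d =>
      (fun y => y + (1 / p.2 : ℝ) • a p.1 p.2 y)^[p.2] ((0 : ℝ), x)) = Ψ 0 := by
    funext x
    have := h3 ((0 : ℝ), x)
    simp only at this
    simp only [Function.comp_apply]
    rw [this]
  rw [e]
  exact h2 0

end


/-- **Corollary (shears generate all Hamiltonian diffeomorphisms).**
For a mechanical control system on `T*ℝ^d` with complete Hamiltonian vector fields: if
every vertical shear `(q,p) ↦ (q, p − ∇f(q))` and every horizontal shear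
`(q,p) ↦ (q + ∇g(p), p)` (with `f, g ∈ C^∞(ℝ^d,ℝ)`) is small-time approximately reachable,
then every Hamiltonian diffeomorphism of `T*ℝ^d` is small-time approximately reachable. -/
theorem shears_generate_hamDiffeos
    (d m : ℕ) (V0 : (Fin d → ℝ) → ℝ) (V : Fin m → (Fin d → ℝ) → ℝ)
    (hV0 : ContDiff ℝ (⊤ : ℕ∞) V0) (hV : ∀ j, ContDiff ℝ (⊤ : ℕ∞) (V j))
    (hcomplete : ∀ u : Fin m → ℝ, ∃ φ, IsFlowOf (hamVF (mechHam V0 V u)) φ)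
    (hvert : ∀ f : (Fin d → ℝ) → ℝ, ContDiff ℝ (⊤ : ℕ∞) f →
      SmallTimeReachable (mechHam V0 V) (vshear f))
    (hhor : ∀ g : (Fin d → ℝ) → ℝ, ContDiff ℝ (⊤ : ℕ∞) g →
      SmallTimeReachable (mechHam V0 V) (hshear g)) :
    ∀ Φ : Phase d → Phase d, IsHamDiffeo Φ →
      SmallTimeReachable (mechHam V0 V) Φ := by
  have hHam : ∀ u, ContDiff ℝ ∞ (mechHam V0 V u) := by
    intro u
    unfold mechHam
    refine ContDiff.add (ContDiff.add ?_ (hV0.comp contDiff_fst)) ?_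
    · fun_prop
    · exact ContDiff.sum fun j _ => contDiff_const.mul ((hV j).comp contDiff_fst)
  intro Φ hΦ
  exact main_assembly hHam hvert hhor Φ hΦ
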